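/- arXiv:2105.14456 — 5 statements merged into one kernel-verified Lean document; each statement's English description precedes it below -/
import Mathlib

section
/- Let G be a finite group, K a nontrivial normal subgroup, and χ a faithful irreducible character of G lying over a nontrivial character of K (i.e., χ ∈ Irr(G|K) with ker(χ) = 1). Then cod(χ) ≠ p for any prime p dividing |G|/|K|. -/
open CategoryTheory

def Irr (G : Type) [Group G] [Fintype G] : Set (G → ℂ) :=
  {χ | ∃ V : FDRep ℂ G, Simple V ∧ χ = V.character}

noncomputable def charDeg (G : Type) [Group G] (χ : G → ℂ) : ℕ := Nat.floor (χ 1).re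

def kerSet (G : Type) [Group G] (χ : G → ℂ) : Set G := {g | χ g = χ 1}

noncomputable def cod (G : Type) [Group G] [Fintype G] (χ : G → ℂ) : ℕ :=
  Fintype.card G / (kerSet G χ).ncard / charDeg G χ

def codSet (G : Type) [Group G] [Fintype G] : Set ℕ := {d | ∃ χ ∈ Irr G, cod G χ = d}

noncomputable def codMult (G : Type) [Group G] [Fintype G] (d : ℕ) : ℕ :=
  {χ ∈ Irr G | cod G χ = d}.ncard

def IsTk' (G : Type) [Group G] [Fintype G] (k : ℕ) : Prop :=
  ∃ d₀ ∈ codSet G, codMult G d₀ = k ∧ ∀ d ∈ codSet G, d ≠ d₀ → codMult G d = 1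

namespace Representation

variable {k G V : Type*} [Field k] [Group G] [AddCommGroup V] [Module k V]

/-- If a subgroup `A` of finite index stabilizes a line, then an irreducible representation
has degree at most the index of `A`. -/
theorem IsIrreducible.finrank_le_index (ρ : Representation k G V) [ρ.IsIrreducible]
    (A : Subgroup G) [A.FiniteIndex] (v : V) (hv : v ≠ 0)
    (hA : ∀ a ∈ A, ρ a v ∈ Submodule.span k {v}) : Module.finrank k V ≤ A.index := by
  classical
  have : Fintype (G ⧸ A) := Fintype.ofFinite _
  let w : G ⧸ A → V := fun q => ρ q.out v
  have mem (g : G) : ρ g v ∈ Submodule.span k (Set.range w) := by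
    obtain ⟨a, ha⟩ := QuotientGroup.mk_out_eq_mul A g
    obtain ⟨c, hc⟩ := Submodule.mem_span_singleton.mp (hA _ (A.inv_mem a.2))
    have : ρ g v = c • w g := by
      rw [show g = (g : G ⧸ A).out * (a : G)⁻¹ by rw [ha]; group, map_mul, Module.End.mul_apply,
        ← hc, map_smul]
      simp [w, ha]
    rw [this]
    exact Submodule.smul_mem _ _ (Submodule.subset_span ⟨_, rfl⟩)
  let S : Subrepresentation ρ := ⟨Submodule.span k (Set.range w), fun g x hx => by
    induction hx using Submodule.span_induction with
    | mem x hx =>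
      obtain ⟨q, rfl⟩ := hx
      rw [← Module.End.mul_apply, ← map_mul]
      exact mem _
    | zero => simp
    | add x y _ _ hx hy => rw [map_add]; exact add_mem hx hy
    | smul c x _ hx => rw [map_smul]; exact Submodule.smul_mem _ _ hx⟩
  have hS : S.toSubmodule = ⊤ := by
    rcases eq_bot_or_eq_top S with h | h
    · have h1 : v ∈ S.toSubmodule := by simpa using mem 1
      rw [h] at h1
      exact absurd ((Submodule.mem_bot k).mp h1) hv
    · rw [h]; rfl
  calc Module.finrank k V = Module.finrank k S.toSubmodule := by rw [hS, finrank_top]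
    _ ≤ Fintype.card (G ⧸ A) := finrank_range_le_card w
    _ = A.index := by rw [Subgroup.index, Nat.card_eq_fintype_card]

theorem IsIrreducible.nontrivial (ρ : Representation k G V) [ρ.IsIrreducible] :
    Nontrivial V :=
  IsSimpleModule.nontrivial (MonoidAlgebra k G) ρ.asModule

variable [FiniteDimensional k V] [IsAlgClosed k]

theorem IsIrreducible.finrank_mul_orderOf_le [Finite G] (ρ : Representation k G V)
    [ρ.IsIrreducible] (a : G) : Module.finrank k V * orderOf a ≤ Nat.card G := by
  have := IsIrreducible.nontrivial ρ
  obtain ⟨μ, hμ⟩ := Module.End.exists_eigenvalue (ρ a)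
  obtain ⟨v, hv⟩ := hμ.exists_hasEigenvector
  have key : Module.finrank k V ≤ (Subgroup.zpowers a).index := by
    refine finrank_le_index ρ _ v hv.2 fun b hb => ?_
    obtain ⟨n, rfl⟩ := mem_powers_iff_mem_zpowers.mpr hb
    simp only [map_pow, hv.pow_apply]
    exact Submodule.smul_mem _ _ (Submodule.mem_span_singleton_self v)
  calc _ ≤ (Subgroup.zpowers a).index * orderOf a := Nat.mul_le_mul_right _ key
    _ = Nat.card G := by rw [← Nat.card_zpowers, Subgroup.index_mul_card]

/-- Burnside's theorem: the group algebra surjects onto the endomorphisms of an irreducible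
representation. -/
theorem IsIrreducible.asAlgebraHom_surjective (ρ : Representation k G V) [ρ.IsIrreducible] :
    Function.Surjective ρ.asAlgebraHom := by
  classical
  intro f
  let F : Module.End (Module.End (MonoidAlgebra k G) ρ.asModule) ρ.asModule :=
    { toFun := fun x => ρ.asModuleEquiv.symm (f (ρ.asModuleEquiv x))
      map_add' := fun x y => by simp
      map_smul' := fun φ x => by
        obtain ⟨c, rfl⟩ := (IsSimpleModule.algebraMap_end_bijective_of_isAlgClosed
          (A := MonoidAlgebra k G) (V := ρ.asModule) k).2 φ
        simp }
  let b := Module.finBasis k V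
  obtain ⟨r, hr⟩ := jacobson_density F (Finset.univ.image fun i => ρ.asModuleEquiv.symm (b i))
  refine ⟨r, b.ext fun i => ?_⟩
  have h := congrArg ρ.asModuleEquiv (hr (ρ.asModuleEquiv.symm (b i)) (by simp))
  rw [asModuleEquiv_map_smul] at h
  simpa [F] using h.symm

theorem IsIrreducible.finrank_sq_le_card [Finite G] (ρ : Representation k G V)
    [ρ.IsIrreducible] : Module.finrank k V ^ 2 ≤ Nat.card G := by
  have h := LinearMap.finrank_le_finrank_of_surjective
    (f := ρ.asAlgebraHom.toLinearMap) (asAlgebraHom_surjective ρ)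
  rw [Module.finrank_linearMap, ← sq,
    Module.finrank_eq_nat_card_basis (MonoidAlgebra.basis G k)] at h
  exact h

end Representation

theorem FDRep.isIrreducible_ρ {k : Type*} [Field k] {G : Type*} [Group G]
    (V : FDRep k G) [Simple V] : Representation.IsIrreducible (FDRep.ρ V) := by
  have hnt : Nontrivial V := by
    by_contra h
    rw [not_nontrivial_iff_subsingleton] at h
    refine id_nonzero V ?_
    ext v
    exact Subsingleton.elim (α := V) _ _
  have : Nontrivial (Subrepresentation V.ρ) := by
    refine ⟨⊥, ⊤, fun h => ?_⟩
    exact bot_ne_top (α := Submodule k V) (congrArg Subrepresentation.toSubmodule h)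
  refine ⟨fun S => ?_⟩
  let ι : FDRep.of S.toRepresentation ⟶ V :=
    ⟨FGModuleCat.ofHom S.toSubmodule.subtype, fun g => by ext; rfl⟩
  have hι : Mono ι := by
    refine ⟨fun {Z} a b hab => ?_⟩
    ext z
    exact congrArg (fun φ : Z ⟶ V => φ.hom.hom.hom z) hab
  by_cases h0 : ι = 0
  · left
    refine Subrepresentation.toSubmodule_injective ((Submodule.eq_bot_iff _).mpr fun v hv => ?_)
    exact congrArg (fun φ : FDRep.of S.toRepresentation ⟶ V => φ.hom.hom.hom ⟨v, hv⟩) h0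
  · right
    have := isIso_of_mono_of_nonzero h0
    refine Subrepresentation.toSubmodule_injective ((Submodule.eq_top_iff').mpr fun v => ?_)
    have h := congrArg (fun φ : V ⟶ V => φ.hom.hom.hom v) (IsIso.inv_hom_id ι)
    have h' : (((inv ι).hom.hom.hom v : S.toSubmodule) : V) = v := h
    rw [← h']
    exact Subtype.property _

/-- If `x` has prime order exceeding `|K|`, then `x` centralizes the normal subgroup `K`. -/
theorem Subgroup.Normal.commute_of_orderOf_prime {G : Type*} [Group G] [Finite G]
    {K : Subgroup G} (hK : K.Normal) {x : G} (hx : (orderOf x).Prime)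
    (hlt : Nat.card K < orderOf x) {y : G} (hy : y ∈ K) : Commute x y := by
  classical
  have := Fintype.ofFinite K
  let f : G →* Equiv.Perm K := (MulAut.toPerm K).comp MulAut.conjNormal
  have h1 : orderOf (f x) ∣ orderOf x := orderOf_map_dvd f x
  have h2 : orderOf (f x) = 1 := by
    rcases (Nat.dvd_prime hx).mp h1 with h | h
    · exact h
    · have h3 : orderOf (f x) ∣ (Nat.card K).factorial := by
        simpa [Fintype.card_perm, Nat.card_eq_fintype_card] using orderOf_dvd_card (x := f x)
      rw [h, hx.dvd_factorial] at h3
      omega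
  have h4 : f x ⟨y, hy⟩ = ⟨y, hy⟩ := by rw [orderOf_eq_one_iff.mp h2]; rfl
  have h5 : x * y * x⁻¹ = y := congrArg Subtype.val h4
  exact mul_inv_eq_iff_eq_mul.mp h5

/-- If `χ ∈ Irr(G|K)` is faithful, then `cod χ ≠ p` for every prime `p`
dividing `|G|/|K|`. -/
theorem cod_ne_prime (G : Type) [Group G] [Fintype G] (K : Subgroup G)
    (hK : K.Normal) (hKnt : K ≠ ⊥) (χ : G → ℂ) (hχ : χ ∈ Irr G)
    (hnotker : ¬ ((K : Set G) ⊆ kerSet G χ))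
    (hfaithful : kerSet G χ = {1}) :
    ∀ p : ℕ, p.Prime → p ∣ Fintype.card G / Nat.card K → cod G χ ≠ p := by
  intro p hp hdvd hcod
  have : Fact p.Prime := ⟨hp⟩
  obtain ⟨V, hV, rfl⟩ := hχ
  have hirr := FDRep.isIrreducible_ρ V
  have hnt := Representation.IsIrreducible.nontrivial V.ρ
  set d := Module.finrank ℂ V with hd
  have hdpos : 0 < d := Module.finrank_pos
  have hdeg : charDeg G V.character = d := by simp [charDeg, hd]
  rw [cod, hfaithful, Set.ncard_singleton, Nat.div_one, hdeg] at hcod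
  rw [← Nat.card_eq_fintype_card] at hcod hdvd
  have hKG : Nat.card K ∣ Nat.card G := K.card_subgroup_dvd_card
  obtain ⟨m, hm⟩ := hdvd
  have hn : Nat.card G = p * (m * Nat.card K) := by
    rw [← mul_assoc, ← hm, Nat.div_mul_cancel hKG]
  have hsq := Representation.IsIrreducible.finrank_sq_le_card V.ρ
  rw [← hd] at hsq
  have hlo : p * d ≤ Nat.card G := hcod ▸ Nat.div_mul_le_self (Nat.card G) d
  have hhi : Nat.card G < (p + 1) * d := Nat.lt_mul_of_div_lt (by omega) hdpos
  have hmK : m * Nat.card K = d := by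
    set e := m * Nat.card K
    have h1 : d ≤ p := by nlinarith
    have h2 : d ≤ e := by
      rw [hn] at hlo
      exact Nat.le_of_mul_le_mul_left hlo hp.pos
    have h3 : e ≤ d := by nlinarith
    omega
  rw [hmK] at hn
  have hdp : d < p := by
    refine lt_of_le_of_ne (by nlinarith) fun h => ?_
    have : IsMulCommutative G :=
      IsPGroup.isMulCommutative_of_card_eq_prime_sq (p := p) (by rw [hn, h, sq])
    have h1 := Representation.IsIrreducible.finrank_eq_one_of_isMulCommutative V.ρ
    exact hp.one_lt.ne' (by omega)
  have hKd : Nat.card K ≤ d := Nat.le_of_dvd hdpos ⟨m, by rw [← hmK, mul_comm]⟩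
  obtain ⟨x, hx⟩ := exists_prime_orderOf_dvd_card' (G := G) p ⟨d, hn⟩
  obtain ⟨y, hy, hy1⟩ := K.bot_or_exists_ne_one.resolve_left hKnt
  have hxy : Commute x y := hK.commute_of_orderOf_prime (hx ▸ hp) (by omega) hy
  have hyK : orderOf y ≤ Nat.card K :=
    Nat.le_of_dvd Nat.card_pos (Subgroup.orderOf_dvd_natCard K hy)
  have hypos : 0 < orderOf y := orderOf_pos y
  have hy2 : 1 < orderOf y := by
    have := mt orderOf_eq_one_iff.mp hy1
    omega
  have hcop : (orderOf x).Coprime (orderOf y) := by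
    rw [hx]
    exact Nat.coprime_of_lt_prime hypos.ne' (by omega) hp
  have hle := Representation.IsIrreducible.finrank_mul_orderOf_le V.ρ (x * y)
  rw [hxy.orderOf_mul_eq_mul_orderOf_of_coprime hcop, hx, ← hd, hn] at hle
  nlinarith [Nat.mul_pos hdpos hp.pos]
end

section
/- Let G be a finite non-abelian p-group which is a T'_k-group for some k ≥ 1. Then p = 2 and G is an extra-special 2-group. Conversely, every extra-special 2-group is a T'_k-group with k = |G/G'| − 1. -/
open CategoryTheory

/-- `G` is extra-special: a `p`-group with `Z(G) = G'` of order `p`. -/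
def IsExtraspecial (p : ℕ) (G : Type) [Group G] : Prop :=
  IsPGroup p G ∧ Subgroup.center G = commutator G ∧
    Nat.card (Subgroup.center G) = p


open Module Representation

section LinearAlgebra

variable {V : Type*} [AddCommGroup V] [Module ℂ V]

/-- An endomorphism of finite order of a complex vector space is diagonalizable. -/
lemma exists_eigenbasis_of_pow_eq_one [FiniteDimensional ℂ V] (f : Module.End ℂ V) {n : ℕ}
    (hn : n ≠ 0) (hf : f ^ n = 1) :
    ∃ (b : Basis (Fin (finrank ℂ V)) ℂ V) (μ : Fin (finrank ℂ V) → ℂ),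
      (∀ i, f (b i) = μ i • b i) ∧ ∀ i, μ i ^ n = 1 := by
  classical
  have hss : f.IsSemisimple := by
    refine Module.End.isSemisimple_of_squarefree_aeval_eq_zero
      (p := (Polynomial.X ^ n - 1 : Polynomial ℂ)) ?_ ?_
    · exact (Polynomial.separable_X_pow_sub_C (1 : ℂ) (by exact_mod_cast hn) one_ne_zero).squarefree
    · simp [hf]
  have htop := hss.iSup_eigenspace_eq_top
  have hint : DirectSum.IsInternal f.eigenspace :=
    DirectSum.isInternal_submodule_of_iSupIndep_of_iSup_eq_top f.eigenspaces_iSupIndep htop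
  let v := fun μ : ℂ => Module.finBasis ℂ (f.eigenspace μ)
  let b := hint.collectedBasis v
  have hb : ∀ i, f (b i) = i.1 • b i := fun i =>
    Module.End.mem_eigenspace_iff.1 (hint.collectedBasis_mem v i)
  let e := b.indexEquiv (Module.finBasis ℂ V)
  have hb' : ∀ i, f (b.reindex e i) = (e.symm i).1 • b.reindex e i := fun i => by
    simp [hb]
  refine ⟨b.reindex e, fun i => (e.symm i).1, hb', fun i => ?_⟩
  have hpow : ∀ k : ℕ, (f ^ k) (b.reindex e i) = (e.symm i).1 ^ k • b.reindex e i := by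
    intro k
    induction k with
    | zero => simp
    | succ k ih => rw [pow_succ', Module.End.mul_apply, ih, map_smul, hb', smul_smul, pow_succ]
  have h := hpow n
  rw [hf, Module.End.one_apply] at h
  exact (smul_left_injective ℂ ((b.reindex e).ne_zero i) (by simpa using h)).symm

lemma trace_eq_sum_of_eigenbasis {ι : Type*} [Fintype ι] (f : Module.End ℂ V) (b : Basis ι ℂ V)
    (μ : ι → ℂ) (h : ∀ i, f (b i) = μ i • b i) : LinearMap.trace ℂ V f = ∑ i, μ i := by
  classical
  rw [LinearMap.trace_eq_matrix_trace ℂ b, Matrix.trace]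
  simp [LinearMap.toMatrix_apply, h]

end LinearAlgebra

section Characters

variable {G : Type} [Group G] [Fintype G]

lemma char_inv_eq_conj (V : FDRep ℂ G) (g : G) :
    V.character g⁻¹ = (starRingEnd ℂ) (V.character g) := by
  have hc : Fintype.card G ≠ 0 := Fintype.card_ne_zero
  obtain ⟨b, μ, hb, hμ⟩ := exists_eigenbasis_of_pow_eq_one (V.ρ g) hc
    (by rw [← map_pow, pow_card_eq_one, map_one])
  have hinv : ∀ i, V.ρ g⁻¹ (b i) = (μ i)⁻¹ • b i := fun i => by
    have h0 : μ i ≠ 0 := fun h => by simpa [h, hc] using hμ i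
    rw [eq_inv_smul_iff₀ h0, ← map_smul, ← hb, ← Module.End.mul_apply, ← map_mul, inv_mul_cancel,
      map_one, Module.End.one_apply]
  rw [FDRep.character, FDRep.character, trace_eq_sum_of_eigenbasis _ b _ hinv,
    trace_eq_sum_of_eigenbasis _ b _ hb, map_sum]
  exact Finset.sum_congr rfl fun i _ =>
    Complex.inv_eq_conj (Complex.norm_eq_one_of_pow_eq_one (hμ i) hc)

lemma char_eq_char_one_iff (V : FDRep ℂ G) (g : G) :
    V.character g = V.character 1 ↔ g ∈ V.ρ.ker := by
  refine ⟨fun h => ?_, fun h => by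
    rw [MonoidHom.mem_ker] at h; rw [FDRep.character, FDRep.character, h, map_one V.ρ]⟩
  have hc : Fintype.card G ≠ 0 := Fintype.card_ne_zero
  obtain ⟨b, μ, hb, hμ⟩ := exists_eigenbasis_of_pow_eq_one (V.ρ g) hc
    (by rw [← map_pow, pow_card_eq_one, map_one])
  rw [FDRep.char_one, FDRep.character, trace_eq_sum_of_eigenbasis _ b _ hb] at h
  have hnorm : ∀ i, ‖μ i‖ = 1 := fun i => Complex.norm_eq_one_of_pow_eq_one (hμ i) hc
  have hle : ∀ i ∈ Finset.univ, (μ i).re ≤ 1 := fun i _ => (Complex.re_le_norm _).trans (hnorm i).le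
  have hsum : ∑ i, (μ i).re = ∑ _i : Fin (finrank ℂ V), (1 : ℝ) := by
    rw [← Complex.re_sum, h]; simp
  have hre := (Finset.sum_eq_sum_iff_of_le hle).1 hsum
  have hone : ∀ i, μ i = 1 := fun i => by
    have h1 := hre i (Finset.mem_univ i)
    have h2 := hnorm i
    have h3 := Complex.sq_norm (μ i)
    rw [h2, Complex.normSq_apply, h1] at h3
    exact Complex.ext h1 (by simp; nlinarith)
  rw [MonoidHom.mem_ker]
  exact b.ext fun i => by rw [hb, hone]; simp

lemma kerSet_character (V : FDRep ℂ G) : kerSet G V.character = (V.ρ.ker : Set G) :=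
  Set.ext fun g => char_eq_char_one_iff V g

omit [Fintype G] in
lemma charDeg_character (V : FDRep ℂ G) : charDeg G V.character = finrank ℂ V := by
  simp [charDeg]

lemma cod_character (V : FDRep ℂ G) :
    cod G V.character = V.ρ.ker.index / finrank ℂ V := by
  rw [cod, charDeg_character, kerSet_character, ← Nat.card_coe_set_eq, ← Nat.card_eq_fintype_card,
    ← V.ρ.ker.card_mul_index]
  congr 1
  exact Nat.mul_div_cancel_left _ Nat.card_pos

lemma finrank_pos_of_simple (V : FDRep ℂ G) [Simple V] : 0 < finrank ℂ V := by
  rw [Nat.pos_iff_ne_zero]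
  intro h0
  have hs : Subsingleton V := finrank_zero_iff.1 h0
  have h := (FDRep.simple_iff_char_is_norm_one V).1 inferInstance
  have hz : ∀ g, V.character g = 0 := fun g => by
    rw [FDRep.character, Subsingleton.elim (V.ρ g) 0, map_zero]
  simp [hz, eq_comm] at h

/-- Schur's lemma for endomorphisms of simple complex representations. -/
lemma exists_eq_smul_one_of_commute (V : FDRep ℂ G) [Simple V] (f : Module.End ℂ V)
    (hf : ∀ g, f * V.ρ g = V.ρ g * f) : ∃ c : ℂ, f = c • 1 := by
  have := invertibleOfNonzero (NeZero.ne (Nat.card G : ℂ))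
  have hr : finrank ℂ (IntertwiningMap V.ρ V.ρ) = 1 := by
    have h := card_inv_mul_sum_char_mul_char_eq_finrank (k := ℂ) V.ρ V.ρ
    have h' := (FDRep.simple_iff_char_is_norm_one V).1 inferInstance
    change (Nat.card G : ℂ)⁻¹ * ∑ g : G, V.character g * V.character g⁻¹ = _ at h
    rw [h', inv_mul_cancel_of_invertible] at h
    exact_mod_cast h.symm
  have h1 : (1 : IntertwiningMap V.ρ V.ρ) ≠ 0 := by
    have : Nontrivial (IntertwiningMap V.ρ V.ρ) :=
      Module.nontrivial_of_finrank_pos (R := ℂ) (by omega)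
    exact one_ne_zero
  obtain ⟨c, hc⟩ := (finrank_eq_one_iff_of_nonzero' _ h1).1 hr ⟨f, hf⟩
  exact ⟨c, (congrArg IntertwiningMap.toLinearMap hc).symm⟩

lemma simple_of_isIrreducible {V : Type} [AddCommGroup V] [Module ℂ V] [FiniteDimensional ℂ V]
    (ρ : Representation ℂ G V) [ρ.IsIrreducible] : Simple (FDRep.of ρ) := by
  have := invertibleOfNonzero (NeZero.ne (Nat.card G : ℂ))
  rw [FDRep.simple_iff_char_is_norm_one]
  have h := char_orthonormal (k := ℂ) ρ ρ
  rw [if_pos ⟨Representation.Equiv.refl ρ⟩, inv_mul_eq_one₀ (NeZero.ne _)] at h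
  exact h.symm

/-- The irreducible representations of a finite group separate its elements. -/
lemma exists_simple_apply_ne_one {g : G} (hg : g ≠ 1) :
    ∃ V : FDRep ℂ G, Simple V ∧ V.ρ g ≠ 1 := by
  by_contra! H
  have key : ∀ a : MonoidAlgebra ℂ G, MonoidAlgebra.single g (1 : ℂ) * a = a := by
    intro a
    have ha : a ∈ sSup {m : Submodule (MonoidAlgebra ℂ G) (MonoidAlgebra ℂ G) |
        IsSimpleModule (MonoidAlgebra ℂ G) m} := by
      rw [IsSemisimpleModule.sSup_simples_eq_top]; trivial
    rw [sSup_eq_iSup'] at ha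
    induction ha using Submodule.iSup_induction' with
    | mem m x hx =>
      have hm : IsSimpleModule (MonoidAlgebra ℂ G) m.1 := m.2
      have hirr : (ofModule' (k := ℂ) (G := G) m.1).IsIrreducible := by
        rw [irreducible_iff_isSimpleModule_asModule]
        let e : (ofModule' (k := ℂ) (G := G) m.1).asModule ≃ₗ[MonoidAlgebra ℂ G] m.1 :=
          { (ofModule' (k := ℂ) (G := G) m.1).asModuleEquiv with
            map_smul' := fun r x => by
              have h := asModuleEquiv_map_smul (ofModule' (k := ℂ) (G := G) m.1) r x
              refine h.trans ?_
              simp [asAlgebraHom, ofModule']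
              rfl }
        exact IsSimpleModule.congr e
      have h' := LinearMap.congr_fun (H _ (simple_of_isIrreducible
        (ofModule' (k := ℂ) (G := G) m.1))) ⟨x, hx⟩
      exact congrArg Subtype.val h'
    | zero => simp
    | add x y _ _ hx hy => rw [mul_add, hx, hy]
  have h1 := key 1
  rw [mul_one, MonoidAlgebra.one_def] at h1
  exact hg (by simpa [MonoidAlgebra.single_left_inj] using h1)


/-- The one-dimensional representation afforded by a homomorphism to `ℂˣ`. -/
noncomputable def linearFDRep (l : G →* ℂˣ) : FDRep ℂ G :=
  FDRep.of ((DistribMulAction.toModuleEnd ℂ ℂ).comp l : Representation ℂ G ℂ)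

omit [Fintype G] in
lemma linearFDRep_ρ_apply (l : G →* ℂˣ) (g : G) :
    (linearFDRep l).ρ g = ((l g : ℂ) • (1 : Module.End ℂ ℂ)) := by
  ext; rfl

omit [Fintype G] in
lemma character_linearFDRep (l : G →* ℂˣ) (g : G) : (linearFDRep l).character g = l g := by
  rw [FDRep.character, linearFDRep_ρ_apply]
  refine (map_smul (LinearMap.trace ℂ ℂ) (l g : ℂ) 1).trans ?_
  simp

instance simple_linearFDRep (l : G →* ℂˣ) : Simple (linearFDRep l) := by
  rw [FDRep.simple_iff_char_is_norm_one]
  simp [character_linearFDRep]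

lemma ker_linearFDRep (l : G →* ℂˣ) : (linearFDRep l).ρ.ker = l.ker := by
  ext g
  rw [← char_eq_char_one_iff, character_linearFDRep, character_linearFDRep, MonoidHom.mem_ker]
  simp

omit [Fintype G] in
lemma finrank_linearFDRep (l : G →* ℂˣ) : finrank ℂ (linearFDRep l) = 1 :=
  finrank_self ℂ

open MonoidalCategory in
lemma simple_tensor_linearFDRep (V : FDRep ℂ G) [Simple V] (l : G →* ℂˣ) :
    Simple (V ⊗ linearFDRep l) := by
  rw [FDRep.simple_iff_char_is_norm_one, ← (FDRep.simple_iff_char_is_norm_one V).1 inferInstance]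
  refine Finset.sum_congr rfl fun g _ => ?_
  rw [FDRep.char_tensor, Pi.mul_apply, Pi.mul_apply, character_linearFDRep, character_linearFDRep,
    mul_mul_mul_comm]
  simp

lemma simple_dual (V : FDRep ℂ G) [Simple V] : Simple (FDRep.of (dual V.ρ)) := by
  rw [FDRep.simple_iff_char_is_norm_one, ← (FDRep.simple_iff_char_is_norm_one V).1 inferInstance]
  refine Finset.sum_congr rfl fun g _ => ?_
  rw [FDRep.char_dual, FDRep.char_dual, inv_inv, mul_comm]

/-- The inflation of a representation along a homomorphism. -/
noncomputable def inflate {H : Type} [Group H] (f : G →* H) (V : FDRep ℂ H) : FDRep ℂ G :=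
  FDRep.of (V.ρ.comp f : Representation ℂ G V)

omit [Fintype G] in
lemma character_inflate {H : Type} [Group H] (f : G →* H) (V : FDRep ℂ H) (g : G) :
    (inflate f V).character g = V.character (f g) := rfl

omit [Fintype G] in
lemma ker_inflate {H : Type} [Group H] (f : G →* H) (V : FDRep ℂ H) :
    (inflate f V).ρ.ker = V.ρ.ker.comap f := rfl

omit [Fintype G] in
lemma finrank_inflate {H : Type} [Group H] (f : G →* H) (V : FDRep ℂ H) :
    finrank ℂ (inflate f V) = finrank ℂ V := rfl

lemma cod_inflate {H : Type} [Group H] [Fintype H] {f : G →* H} (hf : Function.Surjective f)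
    (V : FDRep ℂ H) : cod G (inflate f V).character = cod H V.character := by
  rw [cod_character, cod_character, ker_inflate, finrank_inflate,
    Subgroup.index_comap_of_surjective _ hf]

lemma simple_inflate {H : Type} [Group H] [Fintype H] {f : G →* H} (hf : Function.Surjective f)
    (V : FDRep ℂ H) [Simple V] : Simple (inflate f V) := by
  classical
  rw [FDRep.simple_iff_char_is_norm_one]
  have h := (FDRep.simple_iff_char_is_norm_one V).1 inferInstance
  simp only [character_inflate, map_inv]
  rw [← Finset.sum_fiberwise Finset.univ f]
  have hcard : ∀ y : H, ({x | f x = y} : Finset G).card = Nat.card f.ker := fun y => by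
    rw [MonoidHom.card_fiber_eq_of_mem_range f (hf y) (hf 1), Nat.card_eq_fintype_card,
      Fintype.card_subtype]
    simp only [MonoidHom.mem_ker]
  have hin : ∀ y : H, ∑ x with f x = y, V.character (f x) * V.character (f x)⁻¹ =
      Nat.card f.ker * (V.character y * V.character y⁻¹) := fun y => by
    rw [Finset.sum_congr rfl (g := fun _ => V.character y * V.character y⁻¹)
      (fun x hx => by rw [(Finset.mem_filter.1 hx).2]), Finset.sum_const, hcard, nsmul_eq_mul]
  rw [Finset.sum_congr rfl fun y _ => hin y, ← Finset.mul_sum, h, ← f.ker.card_mul_index,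
    Subgroup.index_ker, MonoidHom.range_eq_top.2 hf]
  simp

lemma exists_apply_eq_smul_one (V : FDRep ℂ G) [Simple V] {z : G}
    (hz : ∀ h, z * h * z⁻¹ * h⁻¹ ∈ V.ρ.ker) : ∃ c : ℂ, V.ρ z = c • 1 := by
  refine exists_eq_smul_one_of_commute V _ fun g => ?_
  have h := hz g
  rw [MonoidHom.mem_ker] at h
  have : z * g = (z * g * z⁻¹ * g⁻¹) * (g * z) := by group
  rw [← map_mul, ← map_mul, this, map_mul, h, one_mul]

omit [Fintype G] in
lemma character_mul_of_apply_eq_smul_one (V : FDRep ℂ G) {z : G} {c : ℂ} (hc : V.ρ z = c • 1)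
    (g : G) : V.character (z * g) = c * V.character g := by
  rw [FDRep.character, map_mul, hc, smul_one_mul, map_smul, smul_eq_mul, FDRep.character]

/-- A simple representation in which a subgroup acts by scalars has small dimension. -/
lemma card_mul_finrank_sq_le (V : FDRep ℂ G) [Simple V] (Z : Subgroup G)
    (hZ : ∀ z ∈ Z, ∃ c : ℂ, V.ρ z = c • 1) :
    Nat.card Z * finrank ℂ V ^ 2 ≤ Nat.card G := by
  classical
  have h := (FDRep.simple_iff_char_is_norm_one V).1 inferInstance
  have hterm : ∀ g, V.character g * V.character g⁻¹ = ((Complex.normSq (V.character g) : ℝ) : ℂ) :=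
    fun g => by rw [char_inv_eq_conj, Complex.mul_conj]
  have hZ' : ∀ z ∈ Z, Complex.normSq (V.character z) = (finrank ℂ V : ℝ) ^ 2 := fun z hz => by
    obtain ⟨c, hc⟩ := hZ z hz
    have h1 := character_mul_of_apply_eq_smul_one V hc 1
    have h2 := character_mul_of_apply_eq_smul_one V hc z⁻¹
    rw [mul_inv_cancel, FDRep.char_one] at h2
    rw [mul_one, FDRep.char_one] at h1
    have h3 := hterm z
    rw [h1, mul_right_comm, ← h2, ← h1] at h3
    rw [sq]
    exact_mod_cast h3.symm
  simp_rw [hterm] at h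
  have hsum : ∑ g : G, Complex.normSq (V.character g) = Nat.card G := by exact_mod_cast h
  have hle : ∑ g : G with g ∈ Z, Complex.normSq (V.character g) ≤ Nat.card G := by
    rw [← hsum]
    exact Finset.sum_le_sum_of_subset_of_nonneg (Finset.filter_subset _ _)
      fun _ _ _ => Complex.normSq_nonneg _
  rw [Finset.sum_congr rfl fun z hz => hZ' z (Finset.mem_filter.1 hz).2, Finset.sum_const,
    nsmul_eq_mul, ← Fintype.card_subtype, ← Nat.card_eq_fintype_card] at hle
  exact_mod_cast hle

lemma finrank_eq_one_of_commutator_le_ker (V : FDRep ℂ G) [Simple V]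
    (h : ∀ a b, a * b * a⁻¹ * b⁻¹ ∈ V.ρ.ker) : finrank ℂ V = 1 := by
  have h1 := card_mul_finrank_sq_le V ⊤ fun z _ => exists_apply_eq_smul_one V (h z)
  rw [Subgroup.card_top] at h1
  have h2 : 0 < Nat.card G := Nat.card_pos
  have h3 := finrank_pos_of_simple V
  have h4 : finrank ℂ V ^ 2 ≤ 1 := Nat.le_of_mul_le_mul_left (by rwa [mul_one]) h2
  nlinarith

omit [Fintype G] in
lemma exists_character_eq_of_finrank_eq_one (V : FDRep ℂ G) (h : finrank ℂ V = 1) :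
    ∃ l : G →* ℂˣ, ∀ g, V.character g = l g := by
  have hs : ∀ g, ∃ c : ℂ, V.ρ g = c • 1 := fun g =>
    (LinearMap.existsUnique_eq_smul_id_of_finrank_eq_one h (V.ρ g)).exists
  have h1 : V.character 1 = 1 := by rw [FDRep.char_one, h, Nat.cast_one]
  let f : G →* ℂ :=
    { toFun := V.character
      map_one' := h1
      map_mul' := fun a b => by
        obtain ⟨c, hc⟩ := hs a
        have h2 := character_mul_of_apply_eq_smul_one V hc 1
        rw [mul_one, h1, mul_one] at h2
        rw [character_mul_of_apply_eq_smul_one V hc, h2] }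
  exact ⟨f.toHomUnits, fun g => rfl⟩

lemma apply_commutator_eq_one_of_finrank_eq_one (V : FDRep ℂ G) (h : finrank ℂ V = 1) (a b : G) :
    a * b * a⁻¹ * b⁻¹ ∈ V.ρ.ker := by
  obtain ⟨l, hl⟩ := exists_character_eq_of_finrank_eq_one V h
  rw [← char_eq_char_one_iff, hl, hl]
  simp [mul_assoc]

/-- A nonabelian finite group has a simple complex representation of dimension at least two. -/
lemma exists_simple_two_le_finrank (hG : ¬ ∀ a b : G, a * b = b * a) :
    ∃ V : FDRep ℂ G, Simple V ∧ 2 ≤ finrank ℂ V := by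
  push Not at hG
  obtain ⟨a, b, hab⟩ := hG
  have hne : a * b * a⁻¹ * b⁻¹ ≠ 1 := fun h => hab (by
    rw [mul_inv_eq_one, mul_inv_eq_iff_eq_mul] at h; exact h)
  obtain ⟨V, hV, hne'⟩ := exists_simple_apply_ne_one hne
  refine ⟨V, hV, ?_⟩
  have := finrank_pos_of_simple V
  by_contra! hlt
  exact hne' (apply_commutator_eq_one_of_finrank_eq_one V (by omega) a b)

lemma prime_mul_finrank_sq_le_index {p : ℕ} (hp : p.Prime) (hG : IsPGroup p G) (V : FDRep ℂ G)
    [Simple V] (hV : 2 ≤ finrank ℂ V) : p * finrank ℂ V ^ 2 ≤ V.ρ.ker.index := by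
  have : Fact p.Prime := ⟨hp⟩
  set K := V.ρ.ker with hK
  have hnt : Nontrivial (G ⧸ K) := by
    by_contra hs
    rw [not_nontrivial_iff_subsingleton, QuotientGroup.subsingleton_iff] at hs
    have := finrank_eq_one_of_commutator_le_ker V fun a b => by rw [← hK, hs]; trivial
    omega
  have hQ : IsPGroup p (G ⧸ K) := hG.to_quotient K
  have hc := hQ.center_nontrivial
  have hpc : p ≤ Nat.card (Subgroup.center (G ⧸ K)) := by
    obtain ⟨n, hn, hn'⟩ := (hQ.to_subgroup (Subgroup.center (G ⧸ K))).nontrivial_iff_card.1 hc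
    rw [hn']
    exact Nat.le_self_pow hn.ne' p
  set Z := (Subgroup.center (G ⧸ K)).comap (QuotientGroup.mk' K)
  have hZ := card_mul_finrank_sq_le V Z fun z hz => exists_apply_eq_smul_one V fun h => by
    rw [← hK, ← QuotientGroup.eq_one_iff]
    have := Subgroup.mem_center_iff.1 (Subgroup.mem_comap.1 hz) (QuotientGroup.mk h)
    simp only [QuotientGroup.mk'_apply] at this
    rw [QuotientGroup.mk_mul, QuotientGroup.mk_mul, QuotientGroup.mk_mul, QuotientGroup.mk_inv,
      QuotientGroup.mk_inv, ← this, mul_inv_cancel_right, mul_inv_cancel]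
  have hZc : Nat.card Z = Nat.card K * Nat.card (Subgroup.center (G ⧸ K)) := by
    have h1 := Z.card_mul_index
    rw [Subgroup.index_comap_of_surjective _ (QuotientGroup.mk'_surjective K)] at h1
    have h2 := (Subgroup.center (G ⧸ K)).card_mul_index
    have h3 := K.card_mul_index
    rw [Subgroup.index, ← h2, ← mul_assoc] at h3
    exact Nat.eq_of_mul_eq_mul_right (Nat.pos_of_ne_zero Subgroup.index_ne_zero_of_finite)
      (h1.trans h3.symm)
  rw [hZc, ← K.card_mul_index, mul_assoc] at hZ
  exact (Nat.mul_le_mul_right _ hpc).trans (Nat.le_of_mul_le_mul_left hZ Nat.card_pos)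

lemma prime_lt_cod {p : ℕ} (hp : p.Prime) (hG : IsPGroup p G) (V : FDRep ℂ G) [Simple V]
    (hV : 2 ≤ finrank ℂ V) : p < cod G V.character := by
  rw [cod_character]
  have h := prime_mul_finrank_sq_le_index hp hG V hV
  have := hp.pos
  refine lt_of_lt_of_le (b := p * finrank ℂ V) (by nlinarith) ?_
  rw [Nat.le_div_iff_mul_le (by omega)]
  linarith

lemma cod_linearFDRep (l : G →* ℂˣ) : cod G (linearFDRep l).character = l.ker.index := by
  rw [cod_character, finrank_linearFDRep, ker_linearFDRep, Nat.div_one]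

lemma cod_eq_of_finrank_eq_of_card_ker_eq {V W : FDRep ℂ G} (hd : finrank ℂ V = finrank ℂ W)
    (hK : Nat.card V.ρ.ker = Nat.card W.ρ.ker) : cod G V.character = cod G W.character := by
  have h1 := V.ρ.ker.card_mul_index
  rw [hK, ← W.ρ.ker.card_mul_index] at h1
  rw [cod_character, cod_character, hd, Nat.eq_of_mul_eq_mul_left Nat.card_pos h1]

lemma cod_dual (V : FDRep ℂ G) : cod G (FDRep.of (dual V.ρ)).character = cod G V.character := by
  have hK : (FDRep.of (dual V.ρ)).ρ.ker = V.ρ.ker := by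
    ext g
    rw [← char_eq_char_one_iff, ← inv_mem_iff, ← char_eq_char_one_iff, FDRep.char_dual,
      FDRep.char_dual, inv_one]
  exact cod_eq_of_finrank_eq_of_card_ker_eq Subspace.dual_finrank_eq (by rw [hK])

end Characters

section PGroup

variable {G : Type} [Group G] [Fintype G]

/-- A nontrivial normal subgroup of a finite `p`-group meets the center nontrivially. -/
lemma exists_mem_center_of_normal_ne_bot {p : ℕ} (hp : p.Prime) (hG : IsPGroup p G)
    (N : Subgroup G) [N.Normal] (hN : N ≠ ⊥) : ∃ z ∈ N, z ∈ Subgroup.center G ∧ z ≠ 1 := by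
  have : Fact p.Prime := ⟨hp⟩
  have hnt : Nontrivial N := N.nontrivial_iff_ne_bot.2 hN
  obtain ⟨n, hn, hcard⟩ := (hG.to_subgroup N).nontrivial_iff_card.1 hnt
  have hC : IsPGroup p (ConjAct G) := hG
  obtain ⟨b, hb, hb1⟩ := hC.exists_fixed_point_of_prime_dvd_card_of_fixed_point N
    (by rw [hcard]; exact dvd_pow_self p hn.ne') (a := 1) (fun g => smul_one g)
  refine ⟨b, b.2, Subgroup.mem_center_iff.2 fun g => ?_, fun h => hb1 (Subtype.ext h.symm)⟩
  have h := congrArg Subtype.val (hb (ConjAct.toConjAct g))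
  change g * b * g⁻¹ = b at h
  exact mul_inv_eq_iff_eq_mul.1 h

/-- Homomorphisms to `ℂˣ` separate the points of an abelian quotient. -/
lemma exists_hom_apply_ne_one (N : Subgroup G) [N.Normal] (hN : ∀ a b, a * b * a⁻¹ * b⁻¹ ∈ N)
    {g : G} (hg : g ∉ N) : ∃ l : G →* ℂˣ, N ≤ l.ker ∧ l g ≠ 1 := by
  have : Fintype (G ⧸ N) := Fintype.ofFinite _
  obtain ⟨V, hV, hne⟩ := exists_simple_apply_ne_one (mt (QuotientGroup.eq_one_iff g).1 hg)
  have h1 : finrank ℂ V = 1 := by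
    refine finrank_eq_one_of_commutator_le_ker V fun a b => ?_
    obtain ⟨a, rfl⟩ := QuotientGroup.mk_surjective a
    obtain ⟨b, rfl⟩ := QuotientGroup.mk_surjective b
    have : ((a * b * a⁻¹ * b⁻¹ : G) : G ⧸ N) = 1 := (QuotientGroup.eq_one_iff _).2 (hN a b)
    change ((a * b * a⁻¹ * b⁻¹ : G) : G ⧸ N) ∈ _
    rw [this]
    exact one_mem _
  obtain ⟨l, hl⟩ := exists_character_eq_of_finrank_eq_one V h1
  refine ⟨l.comp (QuotientGroup.mk' N), fun n hn => ?_, fun h => hne ?_⟩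
  · rw [MonoidHom.mem_ker, MonoidHom.comp_apply, QuotientGroup.mk'_apply,
      (QuotientGroup.eq_one_iff n).2 hn, map_one]
  · refine (char_eq_char_one_iff V _).1 ?_
    rw [MonoidHom.comp_apply, QuotientGroup.mk'_apply] at h
    rw [hl, hl, h, map_one]

lemma normal_and_index_eq_of_isCoatom {p : ℕ} (hp : p.Prime) (hG : IsPGroup p G)
    {M : Subgroup G} (hM : IsCoatom M) : M.Normal ∧ M.index = p := by
  have : Fact p.Prime := ⟨hp⟩
  have hnil := hG.isNilpotent
  refine ⟨Subgroup.NormalizerCondition.normal_of_coatom M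
    Group.normalizerCondition_of_isNilpotent hM, ?_⟩
  obtain ⟨n, hn⟩ := IsPGroup.iff_card.1 (hG.to_subgroup M)
  obtain ⟨i, hi⟩ := hG.index M
  have hi0 : i ≠ 0 := by
    rintro rfl
    exact hM.1 (Subgroup.index_eq_one.1 (by simpa using hi))
  have hdvd : p ^ (n + 1) ∣ Nat.card G := by
    rw [← M.card_mul_index, hn, hi, pow_succ]
    exact mul_dvd_mul_left _ (dvd_pow_self p hi0)
  obtain ⟨K, hK, hMK⟩ := Sylow.exists_subgroup_card_pow_succ hdvd hn
  have hlt : M < K := lt_of_le_of_ne hMK fun h => by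
    rw [h, hK] at hn
    have := Nat.pow_right_injective hp.two_le hn
    omega
  rw [hM.2 K hlt, Subgroup.card_top, ← M.card_mul_index, hn, pow_succ] at hK
  exact Nat.eq_of_mul_eq_mul_left (pow_pos hp.pos n) hK

lemma exists_ker_eq_of_isCoatom {p : ℕ} (hp : p.Prime) (hG : IsPGroup p G)
    {M : Subgroup G} (hM : IsCoatom M) : ∃ l : G →* ℂˣ, l.ker = M ∧ l.ker.index = p := by
  obtain ⟨hn, hi⟩ := normal_and_index_eq_of_isCoatom hp hG hM
  obtain ⟨g, hg⟩ : ∃ g, g ∉ M := by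
    by_contra! h
    exact hM.1 ((Subgroup.eq_top_iff' M).2 h)
  have : Fact p.Prime := ⟨hp⟩
  have hcyc : IsCyclic (G ⧸ M) := isCyclic_of_prime_card (p := p) hi
  obtain ⟨l, hle, hne⟩ := exists_hom_apply_ne_one M (fun a b => by
    rw [← QuotientGroup.eq_one_iff]
    have hc := (IsCyclic.commGroup (α := G ⧸ M)).mul_comm (a : G ⧸ M) (b : G ⧸ M)
    change (a : G ⧸ M) * b = b * a at hc
    change (a : G ⧸ M) * b * (a : G ⧸ M)⁻¹ * (b : G ⧸ M)⁻¹ = 1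
    rw [hc, mul_inv_cancel_right, mul_inv_cancel]) hg
  have hk : l.ker = M := by
    by_contra hne'
    have htop := hM.2 _ (lt_of_le_of_ne hle (Ne.symm hne'))
    exact hne (MonoidHom.mem_ker.1 (htop ▸ Subgroup.mem_top g))
  exact ⟨l, hk, hk ▸ hi⟩

/-- A nonabelian finite `p`-group has two distinct linear characters with kernel of index `p`. -/
lemma exists_two_hom_ker_index_eq {p : ℕ} (hp : p.Prime) (hG : IsPGroup p G)
    (hna : ¬ ∀ a b : G, a * b = b * a) :
    ∃ l m : G →* ℂˣ, l ≠ m ∧ l.ker.index = p ∧ m.ker.index = p := by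
  have hzp : ∀ g : G, Subgroup.zpowers g ≠ ⊤ := fun g h => hna fun a b => by
    obtain ⟨i, rfl⟩ := Subgroup.mem_zpowers_iff.1 (h ▸ Subgroup.mem_top a)
    obtain ⟨j, rfl⟩ := Subgroup.mem_zpowers_iff.1 (h ▸ Subgroup.mem_top b)
    exact (Commute.refl g).zpow_zpow i j
  obtain ⟨M, hM, -⟩ := (eq_top_or_exists_le_coatom (Subgroup.zpowers (1 : G))).resolve_left (hzp 1)
  obtain ⟨g, hg⟩ : ∃ g, g ∉ M := by
    by_contra! h
    exact hM.1 ((Subgroup.eq_top_iff' M).2 h)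
  obtain ⟨M', hM', hle⟩ := (eq_top_or_exists_le_coatom (Subgroup.zpowers g)).resolve_left (hzp g)
  obtain ⟨l, hl, hli⟩ := exists_ker_eq_of_isCoatom hp hG hM
  obtain ⟨m, hm, hmi⟩ := exists_ker_eq_of_isCoatom hp hG hM'
  refine ⟨l, m, ?_, hli, hmi⟩
  rintro rfl
  exact hg (hl ▸ hm.symm ▸ hle (Subgroup.mem_zpowers g))

/-- Irreducible characters with the same codegree, different from `d₀`, are equal. -/
def CodInjectiveOff (G : Type) [Group G] [Fintype G] (d₀ : ℕ) : Prop :=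
  ∀ V W : FDRep ℂ G, Simple V → Simple W → cod G V.character = cod G W.character →
    cod G V.character ≠ d₀ → V.character = W.character

lemma IsTk'.exists_codInjectiveOff {k : ℕ} (h : IsTk' G k) : ∃ d₀, CodInjectiveOff G d₀ := by
  obtain ⟨d₀, -, -, h⟩ := h
  refine ⟨d₀, fun V W hV hW heq hne => ?_⟩
  have h1 := h _ ⟨V.character, ⟨V, hV, rfl⟩, rfl⟩ hne
  obtain ⟨χ, hχ⟩ := Set.ncard_eq_one.1 h1
  have hV' : V.character ∈ ({χ} : Set (G → ℂ)) := hχ ▸ ⟨⟨V, hV, rfl⟩, rfl⟩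
  have hW' : W.character ∈ ({χ} : Set (G → ℂ)) := hχ ▸ ⟨⟨W, hW, rfl⟩, heq.symm⟩
  rw [Set.mem_singleton_iff] at hV' hW'
  rw [hV', hW']

lemma CodInjectiveOff.eq_prime {p d₀ : ℕ} (h : CodInjectiveOff G d₀) (hp : p.Prime)
    (hG : IsPGroup p G) (hna : ¬ ∀ a b : G, a * b = b * a) : d₀ = p := by
  obtain ⟨l, m, hne, hl, hm⟩ := exists_two_hom_ker_index_eq hp hG hna
  by_contra hd
  have hlm := h (linearFDRep l) (linearFDRep m) inferInstance inferInstance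
    (by rw [cod_linearFDRep, cod_linearFDRep, hl, hm])
    (by rw [cod_linearFDRep, hl]; exact Ne.symm hd)
  refine hne (MonoidHom.ext fun g => Units.ext ?_)
  rw [← character_linearFDRep, ← character_linearFDRep, hlm]

lemma CodInjectiveOff.quotient {d₀ : ℕ} (h : CodInjectiveOff G d₀) (N : Subgroup G) [N.Normal]
    [Fintype (G ⧸ N)] : CodInjectiveOff (G ⧸ N) d₀ := by
  intro V W hV hW heq hne
  have hs := QuotientGroup.mk'_surjective N
  have h1 := h _ _ (simple_inflate hs V) (simple_inflate hs W)
    (by rw [cod_inflate hs, cod_inflate hs, heq]) (by rwa [cod_inflate hs])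
  funext g
  obtain ⟨g, rfl⟩ := hs g
  exact congrFun h1 g

lemma CodInjectiveOff.character_inv {d₀ : ℕ} (h : CodInjectiveOff G d₀) (V : FDRep ℂ G) [Simple V]
    (hV : cod G V.character ≠ d₀) (g : G) : V.character g⁻¹ = V.character g := by
  rw [← FDRep.char_dual, ← h V _ inferInstance (simple_dual V) (cod_dual V).symm hV]

lemma sq_mem_ker_of_character_inv (V : FDRep ℂ G) [Simple V]
    (hV : ∀ g, V.character g⁻¹ = V.character g) {z : G}
    (hz : ∀ h, z * h * z⁻¹ * h⁻¹ ∈ V.ρ.ker) : z * z ∈ V.ρ.ker := by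
  obtain ⟨c, hc⟩ := exists_apply_eq_smul_one V hz
  rw [← char_eq_char_one_iff, character_mul_of_apply_eq_smul_one V hc, ← hV,
    ← character_mul_of_apply_eq_smul_one V hc, mul_inv_cancel]

lemma CodInjectiveOff.prime_eq_two {p : ℕ} (h : CodInjectiveOff G p) (hp : p.Prime)
    (hG : IsPGroup p G) (hna : ¬ ∀ a b : G, a * b = b * a) : p = 2 := by
  have : Fact p.Prime := ⟨hp⟩
  obtain ⟨V, hV, hd⟩ := exists_simple_two_le_finrank hna
  have hnt : Nontrivial (G ⧸ V.ρ.ker) := by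
    by_contra hs
    rw [not_nontrivial_iff_subsingleton, QuotientGroup.subsingleton_iff] at hs
    have := finrank_eq_one_of_commutator_le_ker V fun a b => by rw [hs]; trivial
    omega
  have hQ : IsPGroup p (G ⧸ V.ρ.ker) := hG.to_quotient _
  obtain ⟨⟨x, hx⟩, hx1⟩ := (nontrivial_iff_exists_ne 1).1 hQ.center_nontrivial
  obtain ⟨z, rfl⟩ := QuotientGroup.mk_surjective x
  have hz := sq_mem_ker_of_character_inv V
    (h.character_inv V (prime_lt_cod hp hG V hd).ne') (z := z) fun g => by
      rw [← QuotientGroup.eq_one_iff]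
      have hc := Subgroup.mem_center_iff.1 hx (QuotientGroup.mk g)
      rw [QuotientGroup.mk_mul, QuotientGroup.mk_mul, QuotientGroup.mk_mul, QuotientGroup.mk_inv,
        QuotientGroup.mk_inv, ← hc, mul_inv_cancel_right, mul_inv_cancel]
  rw [← QuotientGroup.eq_one_iff, QuotientGroup.mk_mul, ← sq] at hz
  have ho := orderOf_eq_prime hz fun h1 => hx1 (Subtype.ext h1)
  obtain ⟨k, hk⟩ := hQ (z : G ⧸ V.ρ.ker)
  have := (ho ▸ orderOf_dvd_of_pow_eq_one hk : 2 ∣ p ^ k)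
  exact ((Nat.prime_dvd_prime_iff_eq Nat.prime_two hp).1 (Nat.prime_two.dvd_of_dvd_pow this)).symm

end PGroup

section Extraspecial

variable {G : Type} [Group G] [Fintype G]

omit [Fintype G] in
lemma commutator_mem_commutator (a b : G) : a * b * a⁻¹ * b⁻¹ ∈ commutator G :=
  Subgroup.commutator_mem_commutator (Subgroup.mem_top a) (Subgroup.mem_top b)

omit [Fintype G] in
lemma commutator_le_of_forall {N : Subgroup G} (h : ∀ a b : G, a * b * a⁻¹ * b⁻¹ ∈ N) :
    commutator G ≤ N :=
  Subgroup.commutator_le.2 fun a _ b _ => h a b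

lemma exists_apply_eq_smul_one_of_mem_center (V : FDRep ℂ G) [Simple V] {z : G}
    (hz : z ∈ Subgroup.center G) : ∃ c : ℂ, V.ρ z = c • 1 :=
  exists_apply_eq_smul_one V fun h => by
    rw [← Subgroup.mem_center_iff.1 hz h, mul_inv_cancel_right, mul_inv_cancel]
    exact one_mem _

lemma character_eq_zero_of_conj_eq_mul (V : FDRep ℂ G) [Simple V] {z g h : G}
    (hz : z ∈ Subgroup.center G) (hzk : z ∉ V.ρ.ker) (hc : h * g * h⁻¹ = z * g) :
    V.character g = 0 := by
  obtain ⟨c, hρ⟩ := exists_apply_eq_smul_one_of_mem_center V hz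
  have h1 := character_mul_of_apply_eq_smul_one V hρ g
  rw [← hc, FDRep.char_conj] at h1
  have h2 : (c - 1) * V.character g = 0 := by linear_combination -h1
  refine (mul_eq_zero.1 h2).resolve_left fun h3 => hzk ?_
  rw [MonoidHom.mem_ker, hρ, sub_eq_zero.1 h3, one_smul]

lemma character_eq_neg_of_mul_self_eq_one (V : FDRep ℂ G) [Simple V] {z : G}
    (hz : z ∈ Subgroup.center G) (hzk : z ∉ V.ρ.ker) (hz2 : z * z = 1) :
    V.character z = -V.character 1 := by
  obtain ⟨c, hρ⟩ := exists_apply_eq_smul_one_of_mem_center V hz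
  have h1 := character_mul_of_apply_eq_smul_one V hρ z
  have h2 := character_mul_of_apply_eq_smul_one V hρ 1
  rw [hz2] at h1
  rw [mul_one] at h2
  have h3 : V.character z - V.character 1 ≠ 0 := fun h =>
    hzk ((char_eq_char_one_iff V z).1 (sub_eq_zero.1 h))
  have h4 : (V.character z - V.character 1) * (V.character z + V.character 1) = 0 := by
    linear_combination V.character z * h2 - V.character 1 * h1
  exact eq_neg_of_add_eq_zero_left ((mul_eq_zero.1 h4).resolve_left h3)

lemma two_mul_finrank_sq_eq_card (V : FDRep ℂ G) [Simple V] {z : G}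
    (hz : z ∈ Subgroup.center G) (hzk : z ∉ V.ρ.ker) (hz2 : z * z = 1)
    (h0 : ∀ g, g ≠ 1 → g ≠ z → V.character g = 0) : 2 * finrank ℂ V ^ 2 = Nat.card G := by
  classical
  have hz1 : (1 : G) ≠ z := fun h => hzk (h ▸ one_mem _)
  have h := (FDRep.simple_iff_char_is_norm_one V).1 inferInstance
  rw [← Finset.sum_subset (Finset.subset_univ {1, z}) (fun g _ hg => by
      simp only [Finset.mem_insert, Finset.mem_singleton, not_or] at hg
      rw [h0 g hg.1 hg.2, zero_mul]), Finset.sum_pair hz1, inv_one,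
    inv_eq_of_mul_eq_one_left hz2, character_eq_neg_of_mul_self_eq_one V hz hzk hz2,
    FDRep.char_one] at h
  have h' : ((2 * finrank ℂ V ^ 2 : ℕ) : ℂ) = (Nat.card G : ℂ) := by
    rw [← h]
    push_cast
    ring
  exact_mod_cast h'

omit [Fintype G] in
lemma exists_eq_of_card_center_eq_two (h : Nat.card (Subgroup.center G) = 2) :
    ∃ z ∈ Subgroup.center G, z ≠ 1 ∧ z * z = 1 ∧ ∀ x ∈ Subgroup.center G, x = 1 ∨ x = z := by
  obtain ⟨⟨z, hz⟩, hz1, hu⟩ := (Nat.card_eq_two_iff' (1 : Subgroup.center G)).1 h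
  have hz1' : z ≠ 1 := fun h => hz1 (Subtype.ext h)
  have hall : ∀ x ∈ Subgroup.center G, x = 1 ∨ x = z := fun x hx => by
    refine or_iff_not_imp_left.2 fun hx1 => ?_
    exact congrArg Subtype.val (hu ⟨x, hx⟩ fun h => hx1 (congrArg Subtype.val h))
  refine ⟨z, hz, hz1', ?_, hall⟩
  exact (hall _ (mul_mem hz hz)).resolve_right fun h => hz1' (mul_eq_left.1 h)

omit [Fintype G] in
lemma IsExtraspecial.not_comm (h : IsExtraspecial 2 G) : ¬ ∀ a b : G, a * b = b * a := by
  intro hab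
  obtain ⟨z, hz, hz1, -, -⟩ := exists_eq_of_card_center_eq_two h.2.2
  have hle : commutator G ≤ ⊥ := commutator_le_of_forall fun a b => by
    rw [hab a b, mul_inv_cancel_right, mul_inv_cancel]
    exact one_mem _
  exact hz1 (hle (h.2.1 ▸ hz))

/-- A nonlinear irreducible representation of an extra-special `2`-group is faithful, and its
character vanishes off the center. -/
lemma IsExtraspecial.nonlinear (h : IsExtraspecial 2 G) (V : FDRep ℂ G) [Simple V]
    (hV : 2 ≤ finrank ℂ V) :
    V.ρ.ker = ⊥ ∧ 2 * finrank ℂ V ^ 2 = Nat.card G ∧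
      (∀ g ∈ Subgroup.center G, g ≠ 1 → V.character g = -V.character 1) ∧
      ∀ g ∉ Subgroup.center G, V.character g = 0 := by
  obtain ⟨hG, hZ, hcard⟩ := h
  obtain ⟨z, hz, hz1, hz2, hall⟩ := exists_eq_of_card_center_eq_two hcard
  have hzk : z ∉ V.ρ.ker := fun hk => by
    have := finrank_eq_one_of_commutator_le_ker V fun a b => by
      rcases hall _ (hZ ▸ commutator_mem_commutator a b) with h | h
      · rw [h]; exact one_mem _
      · rwa [h]
    omega
  have h0 : ∀ g ∉ Subgroup.center G, V.character g = 0 := fun g hg => by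
    obtain ⟨a, ha⟩ : ∃ a, a * g ≠ g * a := by
      by_contra! H
      exact hg (Subgroup.mem_center_iff.2 H)
    rcases hall _ (hZ ▸ commutator_mem_commutator a g) with h | h
    · exact absurd (mul_inv_eq_iff_eq_mul.1 (mul_inv_eq_one.1 h)) ha
    · exact character_eq_zero_of_conj_eq_mul V hz hzk (mul_inv_eq_iff_eq_mul.1 h)
  refine ⟨?_, two_mul_finrank_sq_eq_card V hz hzk hz2 fun g hg1 hgz => h0 g fun hg => ?_, ?_, h0⟩
  · by_contra hne
    obtain ⟨x, hxk, hx, hx1⟩ := exists_mem_center_of_normal_ne_bot Nat.prime_two hG _ hne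
    exact hzk ((hall x hx).resolve_left hx1 ▸ hxk)
  · exact (hall g hg).elim hg1 hgz
  · intro g hg hg1
    rw [(hall g hg).resolve_left hg1]
    exact character_eq_neg_of_mul_self_eq_one V hz hzk hz2

lemma IsExtraspecial.character_eq_of_nonlinear (h : IsExtraspecial 2 G) (V W : FDRep ℂ G)
    [Simple V] [Simple W] (hV : 2 ≤ finrank ℂ V) (hW : 2 ≤ finrank ℂ W) :
    V.character = W.character := by
  obtain ⟨-, hV2, hVz, hV0⟩ := h.nonlinear V hV
  obtain ⟨-, hW2, hWz, hW0⟩ := h.nonlinear W hW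
  have hd : finrank ℂ V = finrank ℂ W := by
    rw [← hW2] at hV2
    exact Nat.pow_left_injective two_ne_zero (Nat.eq_of_mul_eq_mul_left two_pos hV2)
  have h1 : V.character 1 = W.character 1 := by rw [FDRep.char_one, FDRep.char_one, hd]
  funext g
  by_cases hg : g ∈ Subgroup.center G
  · rcases eq_or_ne g 1 with rfl | hg1
    · exact h1
    · rw [hVz g hg hg1, hWz g hg hg1, h1]
  · rw [hV0 g hg, hW0 g hg]

lemma CodInjectiveOff.mul_self_eq_one (h : CodInjectiveOff G 2) (hG : IsPGroup 2 G) {z : G}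
    (hz : z ∈ Subgroup.center G) : z * z = 1 := by
  by_contra hne
  obtain ⟨V, hV, hVz⟩ := exists_simple_apply_ne_one hne
  refine hVz (MonoidHom.mem_ker.1 ?_)
  by_cases hc : cod G V.character = 2
  · have h1 : finrank ℂ V = 1 := by
      by_contra h1
      have := finrank_pos_of_simple V
      have := prime_lt_cod Nat.prime_two hG V (by omega)
      omega
    rw [cod_character, h1, Nat.div_one] at hc
    exact Subgroup.mul_self_mem_of_index_two hc z
  · refine sq_mem_ker_of_character_inv V (h.character_inv V hc) fun g => ?_
    rw [← Subgroup.mem_center_iff.1 hz g, mul_inv_cancel_right, mul_inv_cancel]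
    exact one_mem _

lemma IsExtraspecial.exists_simple_ker_eq {N : Subgroup G} [N.Normal]
    (h : IsExtraspecial 2 (G ⧸ N)) : ∃ W : FDRep ℂ G, Simple W ∧ W.ρ.ker = N ∧
      2 ≤ finrank ℂ W ∧ 2 * finrank ℂ W ^ 2 = N.index := by
  have : Fintype (G ⧸ N) := Fintype.ofFinite _
  obtain ⟨V, hV, hd⟩ := exists_simple_two_le_finrank h.not_comm
  obtain ⟨hk, hc, -⟩ := h.nonlinear V hd
  refine ⟨inflate (QuotientGroup.mk' N) V, simple_inflate (QuotientGroup.mk'_surjective N) V, ?_,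
    hd, hc⟩
  rw [ker_inflate, hk, MonoidHom.comap_bot, QuotientGroup.ker_mk']

omit [Fintype G] in
lemma mem_zpowers_iff_of_mul_self_eq_one {x : G} (hx : x * x = 1) (g : G) :
    g ∈ Subgroup.zpowers x ↔ g = 1 ∨ g = x := by
  constructor
  · rintro ⟨n, rfl⟩
    change x ^ n = 1 ∨ x ^ n = x
    rcases Int.even_or_odd' n with ⟨k, rfl | rfl⟩
    · left
      rw [zpow_mul, zpow_two, hx, one_zpow]
    · right
      rw [zpow_add, zpow_mul, zpow_two, hx, one_zpow, one_mul, zpow_one]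
  · rintro (rfl | rfl)
    · exact one_mem _
    · exact Subgroup.mem_zpowers _

/-- If every proper nonabelian quotient is extra-special, then the center has order `2`. -/
lemma CodInjectiveOff.card_center_eq_two (h : CodInjectiveOff G 2) (hG : IsPGroup 2 G)
    (hna : ¬ ∀ a b : G, a * b = b * a)
    (hQ : ∀ (N : Subgroup G) [N.Normal], N ≠ ⊥ → (∃ a b, a * b * a⁻¹ * b⁻¹ ∉ N) →
      IsExtraspecial 2 (G ⧸ N)) : Nat.card (Subgroup.center G) = 2 := by
  have : Fact (Nat.Prime 2) := ⟨Nat.prime_two⟩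
  push Not at hna
  obtain ⟨a, b, hab⟩ := hna
  have hnt : Nontrivial G := ⟨_, _, hab⟩
  have hc1 : a * b * a⁻¹ * b⁻¹ ≠ 1 := fun h => hab (mul_inv_eq_iff_eq_mul.1 (mul_inv_eq_one.1 h))
  generalize hc : a * b * a⁻¹ * b⁻¹ = c at hc1
  by_contra hne
  have hcard : 4 ≤ (Subgroup.center G : Set G).ncard := by
    obtain ⟨n, hn⟩ := IsPGroup.iff_card.1 (hG.to_subgroup (Subgroup.center G))
    have hnt' := hG.center_nontrivial
    have h1 : 1 < Nat.card (Subgroup.center G) := Finite.one_lt_card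
    change 4 ≤ Nat.card (Subgroup.center G)
    rw [hn] at h1 hne ⊢
    rcases n with _ | _ | n
    · norm_num at h1
    · norm_num at hne
    · rw [pow_add]
      have := Nat.one_le_two_pow (n := n)
      omega
  have hpair : ({1, c} : Set G).ncard = 2 := Set.ncard_pair hc1.symm
  obtain ⟨x, hx, hx'⟩ := Set.exists_mem_notMem_of_ncard_lt_ncard
    (by omega : ({1, c} : Set G).ncard < (Subgroup.center G : Set G).ncard)
  obtain ⟨y, hy, hy'⟩ := Set.exists_mem_notMem_of_ncard_lt_ncard
    (by
      have := Set.ncard_insert_le x {1, c}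
      omega : (insert x {1, c} : Set G).ncard < (Subgroup.center G : Set G).ncard)
  simp only [Set.mem_insert_iff, Set.mem_singleton_iff, not_or] at hx' hy'
  have key : ∀ x ∈ Subgroup.center G, x ≠ 1 → x ≠ c → ∃ W : FDRep ℂ G, Simple W ∧
      W.ρ.ker = Subgroup.zpowers x ∧ 2 ≤ finrank ℂ W ∧ 2 * (2 * finrank ℂ W ^ 2) = Nat.card G := by
    intro x hx hx1 hxc
    have hx2 := h.mul_self_eq_one hG hx
    have hn : (Subgroup.zpowers x).Normal :=
      ⟨fun n hn g => by
        have hc := Subgroup.mem_center_iff.1 (Subgroup.zpowers_le.2 hx hn) g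
        rwa [hc, mul_inv_cancel_right]⟩
    obtain ⟨W, hW, hk, hd, hi⟩ := (hQ (Subgroup.zpowers x) (mt Subgroup.zpowers_eq_bot.1 hx1)
      ⟨a, b, by
        rw [hc, mem_zpowers_iff_of_mul_self_eq_one hx2]
        exact not_or.2 ⟨hc1, hxc.symm⟩⟩).exists_simple_ker_eq
    refine ⟨W, hW, hk, hd, ?_⟩
    rw [hi, ← (Subgroup.zpowers x).card_mul_index, Nat.card_zpowers,
      orderOf_eq_prime (sq x ▸ hx2) hx1]
  obtain ⟨V, hV, hVk, hVd, hVc⟩ := key x hx hx'.1 hx'.2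
  obtain ⟨W, hW, hWk, hWd, hWc⟩ := key y hy hy'.2.1 hy'.2.2
  have hord : ∀ x ∈ Subgroup.center G, x ≠ 1 → Nat.card (Subgroup.zpowers x) = 2 :=
    fun x hx hx1 => by
      rw [Nat.card_zpowers, orderOf_eq_prime (sq x ▸ h.mul_self_eq_one hG hx) hx1]
  have heq := h V W hV hW (cod_eq_of_finrank_eq_of_card_ker_eq
    (by
      rw [← hWc] at hVc
      exact Nat.pow_left_injective two_ne_zero (by dsimp only; omega))
    (by rw [hVk, hWk, hord x hx hx'.1, hord y hy hy'.2.1]))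
    (prime_lt_cod Nat.prime_two hG V hVd).ne'
  have hyV : y ∈ V.ρ.ker := by
    rw [← char_eq_char_one_iff, heq, char_eq_char_one_iff, hWk]
    exact Subgroup.mem_zpowers y
  rw [hVk, mem_zpowers_iff_of_mul_self_eq_one (h.mul_self_eq_one hG hx)] at hyV
  exact hyV.elim hy'.2.1 hy'.1

lemma ne_two_mul_sq {m n : ℕ} (hn : n ≠ 0) : m ^ 2 ≠ 2 * n ^ 2 := by
  intro h
  have hm : m ≠ 0 := by
    rintro rfl
    simp [hn] at h
  have h' := congrArg (fun k => k.factorization 2) h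
  simp only [Nat.factorization_pow, Nat.factorization_mul two_ne_zero (pow_ne_zero 2 hn),
    Finsupp.add_apply, Finsupp.smul_apply, Nat.prime_two.factorization_self, smul_eq_mul] at h'
  omega

open MonoidalCategory in
/-- If every proper nonabelian quotient is extra-special, then the group is extra-special. -/
lemma CodInjectiveOff.isExtraspecial_of_quotient (h : CodInjectiveOff G 2) (hG : IsPGroup 2 G)
    (hna : ¬ ∀ a b : G, a * b = b * a)
    (hQ : ∀ (N : Subgroup G) [N.Normal], N ≠ ⊥ → (∃ a b, a * b * a⁻¹ * b⁻¹ ∉ N) →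
      IsExtraspecial 2 (G ⧸ N)) : IsExtraspecial 2 G := by
  have hcard := h.card_center_eq_two hG hna hQ
  obtain ⟨z, hz, hz1, hz2, hall⟩ := exists_eq_of_card_center_eq_two hcard
  have hmem : ∀ N : Subgroup G, N.Normal → N ≠ ⊥ → z ∈ N := fun N hN hne => by
    obtain ⟨x, hxN, hx, hx1⟩ := exists_mem_center_of_normal_ne_bot Nat.prime_two hG N hne
    exact (hall x hx).resolve_left hx1 ▸ hxN
  have hnab : ∀ N : Subgroup G, (∀ a b, a * b * a⁻¹ * b⁻¹ ∈ N) → N ≠ ⊥ := by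
    rintro _ hN rfl
    exact hna fun a b => mul_inv_eq_iff_eq_mul.1 (mul_inv_eq_one.1 (Subgroup.mem_bot.1 (hN a b)))
  by_cases hab : ∀ a b : G, a * b * a⁻¹ * b⁻¹ ∈ Subgroup.center G
  · refine ⟨hG, le_antisymm (fun x hx => ?_) (commutator_le_of_forall hab), hcard⟩
    rcases hall x hx with rfl | rfl
    · exact one_mem _
    · exact hmem _ inferInstance (hnab _ commutator_mem_commutator)
  exfalso
  push Not at hab
  have hext := hQ (Subgroup.center G) (fun hb => hz1 (Subgroup.mem_bot.1 (hb ▸ hz))) hab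
  obtain ⟨W, hW, -, hWd, hWi⟩ := hext.exists_simple_ker_eq
  obtain ⟨V, hV, hVz⟩ := exists_simple_apply_ne_one hz1
  have hzk : z ∉ V.ρ.ker := hVz
  have hVk : V.ρ.ker = ⊥ := by
    by_contra hne
    exact hzk (hmem _ inferInstance hne)
  have hVd : 2 ≤ finrank ℂ V := by
    by_contra hlt
    have := finrank_pos_of_simple V
    exact hnab _ (apply_commutator_eq_one_of_finrank_eq_one V (by omega)) hVk
  have hlin : ∀ l : G →* ℂˣ, l z = 1 := fun l =>
    MonoidHom.mem_ker.1 (hmem l.ker inferInstance (hnab _ fun a b => by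
      simp [MonoidHom.mem_ker, mul_assoc]))
  have htensor : ∀ (l : G →* ℂˣ) (g : G), V.character g * l g = V.character g := fun l g => by
    have hchar : ∀ x, (V ⊗ linearFDRep l).character x = V.character x * l x := fun x => by
      rw [FDRep.char_tensor, Pi.mul_apply, character_linearFDRep]
    have hk : (V ⊗ linearFDRep l).ρ.ker = ⊥ := by
      by_contra hne
      refine hzk ?_
      have := hmem _ inferInstance hne
      rwa [← char_eq_char_one_iff, hchar, hchar, hlin, map_one, Units.val_one, mul_one, mul_one,
        char_eq_char_one_iff] at this
    have hd : finrank ℂ V = finrank ℂ (V ⊗ linearFDRep l : FDRep ℂ G) := by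
      have h1 := hchar 1
      rw [map_one, Units.val_one, mul_one, FDRep.char_one, FDRep.char_one] at h1
      exact_mod_cast h1.symm
    rw [← hchar, ← h V _ hV (simple_tensor_linearFDRep V l)
      (cod_eq_of_finrank_eq_of_card_ker_eq hd (by rw [hk, hVk]))
      (prime_lt_cod Nat.prime_two hG V hVd).ne']
  have h0 : ∀ g, g ≠ 1 → g ≠ z → V.character g = 0 := fun g hg1 hgz => by
    by_cases hg : g ∈ commutator G
    · have hgZ : (g : G ⧸ Subgroup.center G) ∈ Subgroup.center (G ⧸ Subgroup.center G) := by
        have hle : commutator G ≤ (commutator (G ⧸ Subgroup.center G)).comap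
            (QuotientGroup.mk' (Subgroup.center G)) :=
          commutator_le_of_forall fun a b =>
            commutator_mem_commutator (a : G ⧸ Subgroup.center G) (b : G ⧸ Subgroup.center G)
        rw [hext.2.1]
        exact hle hg
      obtain ⟨a, ha⟩ : ∃ a, a * g ≠ g * a := by
        by_contra! H
        exact (hall g (Subgroup.mem_center_iff.2 H)).elim hg1 hgz
      have hmemZ : a * g * a⁻¹ * g⁻¹ ∈ Subgroup.center G := by
        rw [← QuotientGroup.eq_one_iff]
        have hc := Subgroup.mem_center_iff.1 hgZ (a : G ⧸ Subgroup.center G)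
        rw [QuotientGroup.mk_mul, QuotientGroup.mk_mul, QuotientGroup.mk_mul, QuotientGroup.mk_inv,
          QuotientGroup.mk_inv, hc, mul_inv_cancel_right, mul_inv_cancel]
      rcases hall _ hmemZ with h1 | h1
      · exact absurd (mul_inv_eq_iff_eq_mul.1 (mul_inv_eq_one.1 h1)) ha
      · exact character_eq_zero_of_conj_eq_mul V hz hzk (mul_inv_eq_iff_eq_mul.1 h1)
    · obtain ⟨l, -, hl⟩ := exists_hom_apply_ne_one _ commutator_mem_commutator hg
      have h1 : V.character g * (l g - 1) = 0 := by linear_combination htensor l g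
      refine (mul_eq_zero.1 h1).resolve_right fun h2 => hl (Units.ext ?_)
      rw [sub_eq_zero.1 h2, Units.val_one]
  have hc := two_mul_finrank_sq_eq_card V hz hzk hz2 h0
  rw [← (Subgroup.center G).card_mul_index, hcard, ← hWi] at hc
  exact ne_two_mul_sq (m := finrank ℂ V) (n := finrank ℂ W) (by omega) (by omega)

end Extraspecial

lemma CodInjectiveOff.isExtraspecial {G : Type} [Group G] [Fintype G] (h : CodInjectiveOff G 2)
    (hG : IsPGroup 2 G) (hna : ¬ ∀ a b : G, a * b = b * a) : IsExtraspecial 2 G := by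
  induction hn : Nat.card G using Nat.strong_induction_on generalizing G with
  | _ n ih =>
    refine h.isExtraspecial_of_quotient hG hna fun N _ hN hab => ?_
    have : Fintype (G ⧸ N) := Fintype.ofFinite _
    refine ih _ ?_ (h.quotient N) (hG.to_quotient N) (fun hcomm => ?_) rfl
    · rw [← hn, ← N.card_mul_index]
      have h1 := (N.one_lt_card_iff_ne_bot).2 hN
      have h2 : 0 < N.index := Nat.pos_of_ne_zero N.index_ne_zero_of_finite
      change N.index < _
      nlinarith
    · obtain ⟨a, b, hab⟩ := hab
      rw [← QuotientGroup.eq_one_iff, QuotientGroup.mk_mul, QuotientGroup.mk_mul,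
        QuotientGroup.mk_mul, QuotientGroup.mk_inv, QuotientGroup.mk_inv, hcomm a b,
        mul_inv_cancel_right, mul_inv_cancel] at hab
      exact hab rfl

section Converse

variable {G : Type} [Group G] [Fintype G]

omit [Fintype G] in
lemma IsExtraspecial.mul_self_mem_commutator (h : IsExtraspecial 2 G) (g : G) :
    g * g ∈ commutator G := by
  obtain ⟨-, hZ, hcard⟩ := h
  obtain ⟨z, hz, hz1, hz2, hall⟩ := exists_eq_of_card_center_eq_two hcard
  rw [← hZ, Subgroup.mem_center_iff]
  intro a
  obtain ⟨e, he, he2, hag⟩ : ∃ e ∈ Subgroup.center G, e * e = 1 ∧ a * g = e * g * a := by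
    have hm : a * g * a⁻¹ * g⁻¹ ∈ Subgroup.center G := hZ ▸ commutator_mem_commutator a g
    refine ⟨_, hm, ?_, by group⟩
    rcases hall _ hm with h | h <;> rw [h]
    · exact mul_one 1
    · exact hz2
  calc a * (g * g) = e * g * (a * g) := by rw [← mul_assoc, hag, mul_assoc, hag]
    _ = e * (g * e) * g * a := by rw [hag]; group
    _ = g * g * a := by
      rw [Subgroup.mem_center_iff.1 he g, ← mul_assoc e e g, he2, one_mul]

lemma IsExtraspecial.index_ker_eq_two (h : IsExtraspecial 2 G) {l : G →* ℂˣ} (hl : l ≠ 1) :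
    l.ker.index = 2 := by
  have hle : commutator G ≤ l.ker :=
    commutator_le_of_forall fun a b => by simp [MonoidHom.mem_ker, mul_assoc]
  have hsq : ∀ g, l g = 1 ∨ l g = -1 := fun g => by
    have h1 := MonoidHom.mem_ker.1 (hle (h.mul_self_mem_commutator g))
    rw [map_mul, Units.ext_iff, Units.val_mul, Units.val_one, mul_self_eq_one_iff] at h1
    exact h1.imp (fun h => Units.ext h) fun h => Units.ext h
  obtain ⟨a, ha⟩ : ∃ a, l a ≠ 1 := by
    by_contra! H
    exact hl (MonoidHom.ext H)
  have hne : (-1 : ℂˣ) ≠ 1 := fun h => ha ((hsq a).elim id fun h' => h'.trans h)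
  refine Subgroup.index_eq_two_iff.2 ⟨a, fun b => ?_⟩
  simp only [MonoidHom.mem_ker, map_mul, (hsq a).resolve_left ha]
  rcases hsq b with hb | hb <;> simp [hb, hne, Xor]

lemma card_monoidHom_units : Nat.card (G →* ℂˣ) = Nat.card (G ⧸ commutator G) := by
  rw [Nat.card_congr (Abelianization.lift (G := G) (A := ℂˣ))]
  exact CommGroup.card_monoidHom_of_hasEnoughRootsOfUnity (Abelianization G) ℂ

/-- The irreducible characters of codegree `2` of an extra-special `2`-group are the nontrivial
linear ones. -/
lemma IsExtraspecial.setOf_cod_eq_two (h : IsExtraspecial 2 G) :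
    {χ ∈ Irr G | cod G χ = 2} = (fun (l : G →* ℂˣ) (g : G) => (l g : ℂ)) '' {1}ᶜ := by
  have hfun : ∀ l : G →* ℂˣ, (linearFDRep l).character = fun g => (l g : ℂ) :=
    fun l => funext (character_linearFDRep l)
  ext χ
  constructor
  · rintro ⟨⟨V, hV, rfl⟩, hc⟩
    have h1 : finrank ℂ V = 1 := by
      by_contra h1
      have := finrank_pos_of_simple V
      have := prime_lt_cod Nat.prime_two h.1 V (by omega)
      omega
    obtain ⟨l, hl⟩ := exists_character_eq_of_finrank_eq_one V h1
    refine ⟨l, ?_, funext fun g => (hl g).symm⟩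
    rintro rfl
    rw [funext hl, ← hfun, cod_linearFDRep, MonoidHom.ker_one, Subgroup.index_top] at hc
    omega
  · rintro ⟨l, hl, rfl⟩
    refine ⟨⟨linearFDRep l, inferInstance, (hfun l).symm⟩, ?_⟩
    dsimp only
    rw [← hfun, cod_linearFDRep, h.index_ker_eq_two hl]

lemma IsExtraspecial.codMult_two (h : IsExtraspecial 2 G) :
    codMult G 2 = Nat.card (G ⧸ commutator G) - 1 := by
  have hinj : Function.Injective fun (l : G →* ℂˣ) (g : G) => (l g : ℂ) := fun l m hlm =>
    MonoidHom.ext fun g => Units.ext (congrFun hlm g)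
  have : Finite (G →* ℂˣ) := Nat.finite_of_card_ne_zero (by
    rw [card_monoidHom_units]
    exact Nat.card_pos.ne')
  rw [codMult, h.setOf_cod_eq_two, Set.ncard_image_of_injective _ hinj, ← card_monoidHom_units,
    ← Set.ncard_add_ncard_compl {(1 : G →* ℂˣ)}, Set.ncard_singleton, Nat.add_sub_cancel_left]

lemma IsExtraspecial.codInjectiveOff (h : IsExtraspecial 2 G) : CodInjectiveOff G 2 := by
  intro V W hV hW heq hne
  have hlin : ∀ U : FDRep ℂ G, Simple U → cod G U.character ≠ 2 → finrank ℂ U = 1 →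
      U.character = fun _ => 1 := by
    intro U hU hc h1
    obtain ⟨l, hl⟩ := exists_character_eq_of_finrank_eq_one U h1
    rcases eq_or_ne l 1 with rfl | hl1
    · exact funext fun g => by rw [hl, MonoidHom.one_apply, Units.val_one]
    · refine absurd ?_ hc
      have hU' : U.character = (linearFDRep l).character :=
        funext fun g => by rw [hl, character_linearFDRep]
      rw [hU', cod_linearFDRep, h.index_ker_eq_two hl1]
  have hmixed : ∀ U U' : FDRep ℂ G, Simple U → Simple U' → cod G U.character = cod G U'.character →
      finrank ℂ U = 1 → finrank ℂ U' ≠ 1 → cod G U.character = 2 := by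
    intro U U' hU hU' heq h1 h1'
    by_contra hc
    have := finrank_pos_of_simple U'
    have hlt := prime_lt_cod Nat.prime_two h.1 U' (by omega)
    have h2 : U.character = (linearFDRep (1 : G →* ℂˣ)).character := by
      rw [hlin U hU hc h1]
      exact funext fun g => by
        rw [character_linearFDRep, MonoidHom.one_apply, Units.val_one]
    rw [← heq, h2, cod_linearFDRep, MonoidHom.ker_one, Subgroup.index_top] at hlt
    omega
  have hVpos := finrank_pos_of_simple V
  have hWpos := finrank_pos_of_simple W
  by_cases hV1 : finrank ℂ V = 1 <;> by_cases hW1 : finrank ℂ W = 1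
  · rw [hlin V hV hne hV1, hlin W hW (heq ▸ hne) hW1]
  · exact absurd (hmixed V W hV hW heq hV1 hW1) hne
  · exact absurd (heq.trans (hmixed W V hW hV heq.symm hW1 hV1)) hne
  · exact h.character_eq_of_nonlinear V W (by omega) (by omega)

lemma IsExtraspecial.isTk' (h : IsExtraspecial 2 G) :
    IsTk' G (Nat.card (G ⧸ commutator G) - 1) := by
  refine ⟨2, ?_, h.codMult_two, ?_⟩
  · obtain ⟨l, -, -, hl, -⟩ := exists_two_hom_ker_index_eq Nat.prime_two h.1 h.not_comm
    exact ⟨_, ⟨linearFDRep l, inferInstance, rfl⟩, by rw [cod_linearFDRep, hl]⟩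
  · rintro d ⟨_, ⟨V, hV, rfl⟩, rfl⟩ hd
    refine Set.ncard_eq_one.2 ⟨V.character, Set.eq_singleton_iff_unique_mem.2
      ⟨⟨⟨V, hV, rfl⟩, rfl⟩, ?_⟩⟩
    rintro _ ⟨⟨W, hW, rfl⟩, hc⟩
    exact (h.codInjectiveOff V W hV hW hc.symm hd).symm

end Converse

/-- A finite non-abelian `p`-group is a `T'_k`-group for some `k ≥ 1` iff
`p = 2` and `G` is extra-special; moreover then `k = |G/G'| - 1`. -/
theorem nonabelian_pGroup_Tk' :
    (∀ (G : Type) [Group G] [Fintype G] (p : ℕ), p.Prime → IsPGroup p G →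
      (¬ ∀ a b : G, a * b = b * a) → (∃ k : ℕ, 1 ≤ k ∧ IsTk' G k) →
      p = 2 ∧ IsExtraspecial 2 G) ∧
    (∀ (G : Type) [Group G] [Fintype G], IsExtraspecial 2 G →
      IsTk' G (Nat.card (G ⧸ commutator G) - 1)) := by
  refine ⟨fun G _ _ p hp hG hna ⟨k, _, hk⟩ => ?_, fun G _ _ h => h.isTk'⟩
  obtain ⟨d₀, h⟩ := hk.exists_codInjectiveOff
  obtain rfl := h.eq_prime hp hG hna
  obtain rfl := h.prime_eq_two hp hG hna
  exact ⟨rfl, h.isExtraspecial hG hna⟩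
end

section
/- Let G be the dihedral group D_{2n} of order 2n with n odd, n ≥ 3. For each divisor d > 1 of n, the number of irreducible characters of G with codegree d is φ(d)/2, where φ is Euler's totient function. -/
open CategoryTheory

namespace DihedralGroup

/-- The values on the dihedral group of the character induced from the rotation character
`i ↦ ζ ^ i`. -/
noncomputable def rotationCharacter (n : ℕ) (ζ : ℂ) : DihedralGroup n → ℂ
  | r i => ζ ^ i.val + ζ ^ (-i).val
  | sr _ => 0

theorem rotationCharacter_r (n : ℕ) (ζ : ℂ) (i : ZMod n) :
    rotationCharacter n ζ (r i) = ζ ^ i.val + ζ ^ (-i).val :=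
  rfl

theorem rotationCharacter_sr (n : ℕ) (ζ : ℂ) (i : ZMod n) : rotationCharacter n ζ (sr i) = 0 :=
  rfl

theorem rotationCharacter_one (n : ℕ) (ζ : ℂ) : rotationCharacter n ζ 1 = 2 := by
  simp only [one_def, rotationCharacter, neg_zero, ZMod.val_zero, pow_zero, one_add_one_eq_two]

theorem sum_eq_sum_r_add_sum_sr {n : ℕ} [NeZero n] (f : DihedralGroup n → ℂ) :
    ∑ g, f g = ∑ i, f (r i) + ∑ i, f (sr i) := by
  rw [← equivSum.symm.sum_comp, Fintype.sum_sum_type]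
  rfl

/-- The matrices of the two-dimensional representation of the dihedral group induced from an
additive character of the rotations. -/
def inducedMatrix {n : ℕ} (ψ : AddChar (ZMod n) ℂ) :
    DihedralGroup n →* Matrix (Fin 2) (Fin 2) ℂ where
  toFun
    | r i => !![ψ i, 0; 0, ψ (-i)]
    | sr i => !![0, ψ (-i); ψ i, 0]
  map_one' := by
    rw [one_def]
    simp [Matrix.one_fin_two]
  map_mul' := by
    rintro (i | i) (j | j) <;>
      simp [← AddChar.map_add_eq_mul, sub_eq_add_neg, add_comm]

/-- The two-dimensional representation of the dihedral group induced from an additive character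
of the rotations. -/
noncomputable def inducedRep {n : ℕ} (ψ : AddChar (ZMod n) ℂ) : FDRep ℂ (DihedralGroup n) :=
  FDRep.of ((Matrix.toLinAlgEquiv' : Matrix (Fin 2) (Fin 2) ℂ ≃ₐ[ℂ] _).toMonoidHom.comp
    (inducedMatrix ψ) : Representation ℂ (DihedralGroup n) (Fin 2 → ℂ))

theorem character_inducedRep {n : ℕ} (ψ : AddChar (ZMod n) ℂ) (g : DihedralGroup n) :
    (inducedRep ψ).character g = (inducedMatrix ψ g).trace :=
  Matrix.trace_toLin'_eq (inducedMatrix ψ g)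

theorem character_inducedRep_zmodChar {n : ℕ} [NeZero n] {ζ : ℂ} (hζ : ζ ^ n = 1) :
    (inducedRep (AddChar.zmodChar n hζ)).character = rotationCharacter n ζ := by
  ext (i | i) <;> rw [character_inducedRep] <;>
    simp [inducedMatrix, Matrix.trace_fin_two, rotationCharacter, AddChar.zmodChar_apply]

theorem simple_inducedRep {n : ℕ} [NeZero n] (ψ : AddChar (ZMod n) ℂ) (hψ : ψ * ψ ≠ 1) :
    Simple (inducedRep ψ) := by
  rw [FDRep.simple_iff_char_is_norm_one, sum_eq_sum_r_add_sum_sr]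
  have hsum : ∑ i, ψ i * ψ i = 0 := AddChar.sum_eq_zero_of_ne_one hψ
  have hsum' : ∑ i, ψ (-i) * ψ (-i) = 0 := by
    rw [← hsum]
    exact Equiv.sum_comp (Equiv.neg _) fun i => ψ i * ψ i
  have hone (i : ZMod n) : ψ i * ψ (-i) = 1 := by
    rw [← AddChar.map_add_eq_mul, add_neg_cancel, AddChar.map_zero_eq_one]
  have hterm (i : ZMod n) : (ψ i + ψ (-i)) * (ψ (-i) + ψ i) =
      ψ i * ψ i + ψ (-i) * ψ (-i) + 2 := by
    linear_combination 2 * hone i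
  simp [character_inducedRep, inducedMatrix, Matrix.trace_fin_two, hterm, Finset.sum_add_distrib,
    hsum, hsum', Nat.card_eq_fintype_card, card, mul_comm]

theorem zmodChar_mul_self_ne_one {n : ℕ} [NeZero n] (hodd : Odd n) {ζ : ℂ} (hζ : ζ ^ n = 1)
    (hne : ζ ≠ 1) : AddChar.zmodChar n hζ * AddChar.zmodChar n hζ ≠ 1 := by
  intro h
  have h1 := DFunLike.congr_fun h ((1 : ℕ) : ZMod n)
  rw [AddChar.mul_apply, AddChar.zmodChar_apply', pow_one, AddChar.one_apply, ← sq] at h1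
  obtain ⟨k, hk⟩ := hodd
  rw [hk, pow_succ, pow_mul, h1, one_pow, one_mul] at hζ
  exact hne hζ

theorem rotationCharacter_mem_Irr {n : ℕ} [NeZero n] (hodd : Odd n) {ζ : ℂ} (hζ : ζ ^ n = 1)
    (hne : ζ ≠ 1) : rotationCharacter n ζ ∈ Irr (DihedralGroup n) :=
  ⟨_, simple_inducedRep _ (zmodChar_mul_self_ne_one hodd hζ hne),
    (character_inducedRep_zmodChar hζ).symm⟩

/-- A nontrivial endomorphism of finite order has an eigenvalue other than `1`. -/
theorem exists_eigenvector_ne_one {V : Type*} [AddCommGroup V] [Module ℂ V]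
    [FiniteDimensional ℂ V] {n : ℕ} (hn : n ≠ 0) (T : Module.End ℂ V) (hT : T ^ n = 1)
    (hne : T ≠ 1) : ∃ ζ : ℂ, ζ ≠ 1 ∧ ζ ^ n = 1 ∧ ∃ v, v ≠ 0 ∧ T v = ζ • v := by
  let R := LinearMap.range (T - 1)
  have hR : ∀ x ∈ R, T x ∈ R := by
    rintro _ ⟨y, rfl⟩
    exact ⟨T y, by simp⟩
  have : Nontrivial R := by
    rw [Submodule.nontrivial_iff_ne_bot, Ne, LinearMap.range_eq_bot, sub_eq_zero]
    exact hne
  obtain ⟨ζ, hζ⟩ := Module.End.exists_eigenvalue (T.restrict hR)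
  obtain ⟨⟨x, hx⟩, hv⟩ := hζ.exists_hasEigenvector
  have hx0 : x ≠ 0 := fun h => hv.2 (Subtype.ext h)
  have hTx : T x = ζ • x := congrArg Subtype.val hv.apply_eq_smul
  have hpow (k : ℕ) : (T ^ k) x = ζ ^ k • x := by
    induction k with
    | zero => simp
    | succ k ih => rw [pow_succ, Module.End.mul_apply, hTx, map_smul, ih, smul_smul, pow_succ']
  refine ⟨ζ, ?_, ?_, x, hx0, hTx⟩
  · rintro rfl
    obtain ⟨y, rfl⟩ := hx
    have h := LinearMap.congr_fun (geom_sum_mul T n) y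
    rw [hT, Module.End.mul_apply] at h
    simp only [LinearMap.sum_apply, hpow, one_pow, one_smul, Finset.sum_const, Finset.card_range,
      sub_self, LinearMap.zero_apply] at h
    rw [← Nat.cast_smul_eq_nsmul ℂ] at h
    exact hx0 ((smul_eq_zero_iff_right (Nat.cast_ne_zero.mpr hn)).mp h)
  · have h := hpow n
    rw [hT, Module.End.one_apply] at h
    exact smul_left_injective ℂ hx0 (by simpa using h.symm)

theorem exists_inducedRep_hom {n : ℕ} (ψ : AddChar (ZMod n) ℂ) (V : FDRep ℂ (DihedralGroup n))
    {v : V} (hv : v ≠ 0) (hψ : ∀ i, V.ρ (r i) v = ψ i • v) :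
    ∃ f : inducedRep ψ ⟶ V, f ≠ 0 := by
  let w : V := V.ρ (sr 0) v
  have hs (i : ZMod n) : V.ρ (sr i) v = ψ i • w := by
    rw [← map_smul, ← hψ, ← Module.End.mul_apply, ← map_mul, sr_mul_r, zero_add]
  have hrw (i : ZMod n) : V.ρ (r i) w = ψ (-i) • w := by
    rw [← hs, ← Module.End.mul_apply, ← map_mul, r_mul_sr, zero_sub]
  have hsw (i : ZMod n) : V.ρ (sr i) w = ψ (-i) • v := by
    rw [← hψ, ← Module.End.mul_apply, ← map_mul, sr_mul_sr, zero_sub]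
  let L : (Fin 2 → ℂ) →ₗ[ℂ] V := Fintype.linearCombination ℂ ![v, w]
  have hL (x : Fin 2 → ℂ) : L x = x 0 • v + x 1 • w := by
    simp [L, Fintype.linearCombination_apply]
  have hcomm (g : DihedralGroup n) (x : Fin 2 → ℂ) :
      L ((inducedMatrix ψ g).mulVec x) = V.ρ g (L x) := by
    obtain i | i := g <;>
      simp [hL, inducedMatrix, dotProduct, Fin.sum_univ_two, hψ, hs, hrw, hsw,
        smul_smul, mul_comm, add_comm]
  let f : inducedRep ψ ⟶ V := ⟨InducedCategory.homMk (ModuleCat.ofHom L), fun g => by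
    ext x
    exact hcomm g x⟩
  refine ⟨f, fun hf => hv ?_⟩
  have h0 : L = 0 := congrArg (fun φ : inducedRep ψ ⟶ V => φ.hom.hom.hom) hf
  have h1 := hL ![1, 0]
  rw [h0] at h1
  simpa using h1.symm

/-- An irreducible character of a dihedral group of odd degree either is trivial on the rotations
or is induced from a nontrivial character of the rotations. -/
theorem eq_rotationCharacter_of_mem_Irr {n : ℕ} [NeZero n] (hodd : Odd n)
    {χ : DihedralGroup n → ℂ} (hχ : χ ∈ Irr (DihedralGroup n)) :
    (∀ i, χ (r i) = χ 1) ∨ ∃ ζ : ℂ, ζ ≠ 1 ∧ ζ ^ n = 1 ∧ χ = rotationCharacter n ζ := by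
  obtain ⟨V, hV, rfl⟩ := hχ
  have hr (i : ZMod n) : V.ρ (r i) = V.ρ (r 1) ^ i.val := by
    rw [← map_pow, r_one_pow, ZMod.natCast_zmod_val]
  by_cases hone : V.ρ (r 1) = 1
  · left
    intro i
    simp only [FDRep.character]
    rw [hr, hone, one_pow, map_one V.ρ]
  · right
    obtain ⟨ζ, hne, hζ, v, hv, hTv⟩ := exists_eigenvector_ne_one (NeZero.ne n) (V.ρ (r 1))
      (by rw [← map_pow, r_one_pow_n, map_one]) hone
    refine ⟨ζ, hne, hζ, ?_⟩
    have hpow (k : ℕ) : (V.ρ (r 1) ^ k) v = ζ ^ k • v := by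
      induction k with
      | zero => simp
      | succ k ih => rw [pow_succ, Module.End.mul_apply, hTv, map_smul, ih, smul_smul, pow_succ']
    obtain ⟨f, hf⟩ := exists_inducedRep_hom (AddChar.zmodChar n hζ) V hv fun i => by
      rw [hr, hpow, AddChar.zmodChar_apply]
    have := simple_inducedRep _ (zmodChar_mul_self_ne_one hodd hζ hne)
    have := isIso_of_hom_simple hf
    rw [← character_inducedRep_zmodChar hζ]
    exact (FDRep.char_iso (asIso f)).symm

theorem cod_le_two {n : ℕ} [NeZero n] {χ : DihedralGroup n → ℂ} (hχ : ∀ i, χ (r i) = χ 1) :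
    cod (DihedralGroup n) χ ≤ 2 := by
  have hsub : Set.range (r : ZMod n → DihedralGroup n) ⊆ kerSet (DihedralGroup n) χ := by
    rintro _ ⟨i, rfl⟩
    exact hχ i
  have hcard : n ≤ (kerSet (DihedralGroup n) χ).ncard := by
    refine le_trans (le_of_eq ?_) (Set.ncard_le_ncard hsub)
    rw [← Set.image_univ, Set.ncard_image_of_injective _ fun i j h => by injection h]
    simp
  calc _ ≤ Fintype.card (DihedralGroup n) / (kerSet (DihedralGroup n) χ).ncard :=
        Nat.div_le_self _ _
    _ ≤ 2 * n / n := by rw [card]; exact Nat.div_le_div_left hcard (NeZero.pos n)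
    _ = 2 := Nat.mul_div_cancel _ (NeZero.pos n)

theorem pow_val_mul_pow_val_neg {n : ℕ} [NeZero n] {ζ : ℂ} (hζ : ζ ^ n = 1) (i : ZMod n) :
    ζ ^ i.val * ζ ^ (-i).val = 1 := by
  simp only [← AddChar.zmodChar_apply hζ]
  rw [← AddChar.map_add_eq_mul, add_neg_cancel, AddChar.map_zero_eq_one]

theorem ncard_kerSet_rotationCharacter {n : ℕ} [NeZero n] {ζ : ℂ} (hζ : ζ ^ n = 1) :
    (kerSet (DihedralGroup n) (rotationCharacter n ζ)).ncard = n / orderOf ζ := by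
  have hd : orderOf ζ ∣ n := orderOf_dvd_of_pow_eq_one hζ
  have hpos : 0 < orderOf ζ := Nat.pos_of_dvd_of_pos hd (NeZero.pos n)
  have hker : kerSet (DihedralGroup n) (rotationCharacter n ζ) =
      (fun k : ℕ => r ((orderOf ζ * k : ℕ) : ZMod n)) '' Set.Iio (n / orderOf ζ) := by
    ext (i | i)
    · have hmul := pow_val_mul_pow_val_neg hζ i
      have hiff : r i ∈ kerSet (DihedralGroup n) (rotationCharacter n ζ) ↔ ζ ^ i.val = 1 := by
        simp only [kerSet, Set.mem_ofPred_eq, rotationCharacter_one, rotationCharacter_r]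
        refine ⟨fun h => ?_, fun h => ?_⟩
        · have : (ζ ^ i.val - 1) ^ 2 = 0 := by linear_combination ζ ^ i.val * h - hmul
          exact sub_eq_zero.mp (pow_eq_zero_iff two_ne_zero |>.mp this)
        · rw [h, one_mul] at hmul
          rw [h, hmul, one_add_one_eq_two]
      rw [hiff, ← orderOf_dvd_iff_pow_eq_one]
      constructor
      · rintro ⟨k, hk⟩
        refine ⟨k, ?_, ?_⟩
        · rw [Set.mem_Iio, Nat.lt_div_iff_mul_lt' hd, ← hk]
          exact i.val_lt
        · simp only [← hk, ZMod.natCast_zmod_val]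
      · rintro ⟨k, hk, h⟩
        rw [Set.mem_Iio, Nat.lt_div_iff_mul_lt' hd] at hk
        injection h with h
        rw [← h, ZMod.val_natCast_of_lt hk]
        exact dvd_mul_right _ _
    · simp [kerSet, rotationCharacter_one, rotationCharacter_sr]
  rw [hker, Set.InjOn.ncard_image]
  · simp [Set.ncard_eq_toFinset_card']
  · intro a ha b hb h
    rw [Set.mem_Iio, Nat.lt_div_iff_mul_lt' hd] at ha hb
    injection h with h
    have h' := congrArg ZMod.val h
    rw [ZMod.val_natCast_of_lt ha, ZMod.val_natCast_of_lt hb] at h'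
    exact Nat.eq_of_mul_eq_mul_left hpos h'

theorem cod_rotationCharacter {n : ℕ} [NeZero n] {ζ : ℂ} (hζ : ζ ^ n = 1) :
    cod (DihedralGroup n) (rotationCharacter n ζ) = orderOf ζ := by
  have hdeg : charDeg (DihedralGroup n) (rotationCharacter n ζ) = 2 := by
    simp [charDeg, rotationCharacter_one]
  have hd : orderOf ζ ∣ n := orderOf_dvd_of_pow_eq_one hζ
  rw [cod, hdeg, ncard_kerSet_rotationCharacter hζ, card,
    Nat.mul_div_assoc _ (Nat.div_dvd_of_dvd hd), Nat.div_div_self hd (NeZero.ne n),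
    Nat.mul_div_cancel_left _ two_pos]

theorem rotationCharacter_inv {n : ℕ} [NeZero n] {ζ : ℂ} (hζ : ζ ^ n = 1) :
    rotationCharacter n ζ⁻¹ = rotationCharacter n ζ := by
  ext (i | i)
  · have hmul := pow_val_mul_pow_val_neg hζ i
    rw [rotationCharacter_r, rotationCharacter_r, inv_pow, inv_pow,
      inv_eq_of_mul_eq_one_right hmul, inv_eq_of_mul_eq_one_left hmul, add_comm]
  · rfl

theorem rotationCharacter_eq_iff {n : ℕ} [NeZero n] {ζ ξ : ℂ} (hζ : ζ ^ n = 1) (hξ : ξ ^ n = 1) :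
    rotationCharacter n ξ = rotationCharacter n ζ ↔ ξ = ζ ∨ ξ = ζ⁻¹ := by
  refine ⟨fun h => ?_, ?_⟩
  · have hval {η : ℂ} (hη : η ^ n = 1) :
        η ≠ 0 ∧ rotationCharacter n η (r 1) = η + η⁻¹ := by
      have hmul := pow_val_mul_pow_val_neg hη 1
      have hfst : η ^ (1 : ZMod n).val = η := by
        simpa using (AddChar.zmodChar_apply hη ((1 : ℕ) : ZMod n)).symm.trans
          (AddChar.zmodChar_apply' hη 1)
      rw [hfst] at hmul
      refine ⟨left_ne_zero_of_mul_eq_one hmul, ?_⟩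
      rw [rotationCharacter_r, hfst, eq_inv_of_mul_eq_one_right hmul]
    obtain ⟨hζ0, hζr⟩ := hval hζ
    obtain ⟨hξ0, hξr⟩ := hval hξ
    have h1 := congrFun h (r 1)
    rw [hζr, hξr] at h1
    have h2 : (ξ - ζ) * (ξ - ζ⁻¹) = 0 := by
      linear_combination ξ * h1 - mul_inv_cancel₀ hξ0 + mul_inv_cancel₀ hζ0
    simpa [sub_eq_zero] using h2
  · rintro (rfl | rfl)
    · rfl
    · exact rotationCharacter_inv hζ

theorem setOf_mem_Irr_and_cod_eq {n : ℕ} [NeZero n] (hodd : Odd n) {d : ℕ} (hd : d ∣ n)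
    (h1 : 2 < d) :
    {χ ∈ Irr (DihedralGroup n) | cod (DihedralGroup n) χ = d} =
      rotationCharacter n '' (primitiveRoots d ℂ : Set ℂ) := by
  ext χ
  simp only [Set.mem_ofPred_eq, Set.mem_image, Finset.mem_coe, mem_primitiveRoots (by omega : 0 < d)]
  constructor
  · rintro ⟨hχ, hcod⟩
    obtain h | ⟨ζ, -, hζ, rfl⟩ := eq_rotationCharacter_of_mem_Irr hodd hχ
    · have := cod_le_two h
      omega
    · rw [cod_rotationCharacter hζ] at hcod
      exact ⟨ζ, hcod ▸ IsPrimitiveRoot.orderOf ζ, rfl⟩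
  · rintro ⟨ζ, hζ, rfl⟩
    have hn : ζ ^ n = 1 := (hζ.pow_eq_one_iff_dvd n).mpr hd
    exact ⟨rotationCharacter_mem_Irr hodd hn (hζ.ne_one (by omega)),
      by rw [cod_rotationCharacter hn, hζ.eq_orderOf]⟩

theorem totient_eq_two_mul_card_image {n : ℕ} [NeZero n] {d : ℕ} (hd : d ∣ n) (h1 : 2 < d)
    [DecidableEq (DihedralGroup n → ℂ)] :
    d.totient = 2 * ((primitiveRoots d ℂ).image (rotationCharacter n)).card := by
  have hprim {ζ : ℂ} : ζ ∈ primitiveRoots d ℂ ↔ IsPrimitiveRoot ζ d :=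
    mem_primitiveRoots (by omega)
  have hpow {ζ : ℂ} (hζ : IsPrimitiveRoot ζ d) : ζ ^ n = 1 := (hζ.pow_eq_one_iff_dvd n).mpr hd
  rw [← Complex.card_primitiveRoots d, Finset.card_eq_sum_card_image (rotationCharacter n),
    mul_comm]
  refine Finset.sum_const_nat fun χ hχ => ?_
  obtain ⟨ζ, hζ, rfl⟩ := Finset.mem_image.mp hχ
  rw [hprim] at hζ
  have hne : ζ ≠ ζ⁻¹ := by
    intro h
    have hsq : ζ ^ 2 = 1 := by
      rw [sq]
      nth_rewrite 2 [h]
      exact mul_inv_cancel₀ (hζ.ne_zero (by omega))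
    exact absurd (Nat.le_of_dvd two_pos (hζ.dvd_of_pow_eq_one 2 hsq)) (by omega)
  rw [← Finset.card_pair hne]
  congr 1
  ext ξ
  rw [Finset.mem_filter, hprim, Finset.mem_insert, Finset.mem_singleton]
  constructor
  · rintro ⟨hξ, h⟩
    exact (rotationCharacter_eq_iff (hpow hζ) (hpow hξ)).mp h
  · intro h
    have hξ : IsPrimitiveRoot ξ d := by
      obtain rfl | rfl := h
      exacts [hζ, hζ.inv]
    exact ⟨hξ, (rotationCharacter_eq_iff (hpow hζ) (hpow hξ)).mpr h⟩

end DihedralGroup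

/-- In the dihedral group `D_{2n}` (`n` odd, `n ≥ 3`), for each divisor
`d > 1` of `n` the number of irreducible characters of codegree `d`
is `φ(d)/2`. -/
theorem dihedral_codMult (n : ℕ) [NeZero n] (hodd : Odd n) (h3 : 3 ≤ n)
    (d : ℕ) (hd : d ∣ n) (h1 : 1 < d) :
    codMult (DihedralGroup n) d = Nat.totient d / 2 := by
  classical
  have h2 : 2 < d := by
    obtain ⟨k, hk⟩ := hodd.of_dvd_nat hd
    omega
  rw [codMult, DihedralGroup.setOf_mem_Irr_and_cod_eq hodd hd h2, ← Finset.coe_image,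
    Set.ncard_coe_finset, DihedralGroup.totient_eq_two_mul_card_image hd h2,
    Nat.mul_div_cancel_left _ two_pos]
end

section
/- Let p be an odd prime and β ≥ 1, and let G = C_p^β ⋊ C₂ be the Frobenius group in which the involution inverts every element of C_p^β. Then G has exactly (p^β − 1)/2 nonlinear irreducible characters, all of degree 2 and codegree p, and exactly two linear characters; hence G is a T'_{(p^β−1)/2}-group. -/
open CategoryTheory

section Irreducible

variable {G : Type} [Group G] [Fintype G]

theorem sum_mul_inv_eq_zero_of_mem_Irr {χ φ : G → ℂ} (hχ : χ ∈ Irr G) (hφ : φ ∈ Irr G)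
    (hne : χ ≠ φ) : ∑ g, χ g * φ g⁻¹ = 0 := by
  obtain ⟨V, hV, rfl⟩ := hχ
  obtain ⟨W, hW, rfl⟩ := hφ
  have hG : (Nat.card G : ℂ) ≠ 0 := Nat.cast_ne_zero.mpr Nat.card_pos.ne'
  have := invertibleOfNonzero hG
  have h := FDRep.char_orthonormal V W
  rw [if_neg fun ⟨i⟩ => hne (FDRep.char_iso i)] at h
  simpa [hG] using h

theorem apply_one_ne_zero_of_mem_Irr {χ : G → ℂ} (hχ : χ ∈ Irr G) : χ 1 ≠ 0 := by
  obtain ⟨V, hV, rfl⟩ := hχ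
  intro h
  have hG : (Nat.card G : ℂ) ≠ 0 := Nat.cast_ne_zero.mpr Nat.card_pos.ne'
  rw [FDRep.char_one, Nat.cast_eq_zero] at h
  have : Subsingleton V := Module.finrank_zero_iff.mp h
  have hzero : ∀ g, V.character g = 0 := fun g => by
    rw [FDRep.character, Subsingleton.elim (V.ρ g) 0, map_zero]
  have hnorm := (FDRep.simple_iff_char_is_norm_one V).mp hV
  simp only [hzero, mul_zero, Finset.sum_const_zero] at hnorm
  exact hG hnorm.symm

theorem trace_mem_Irr {n : ℕ} (ρ : G →* Matrix (Fin n) (Fin n) ℂ)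
    (hρ : ∑ g, (ρ g).trace * (ρ g⁻¹).trace = Nat.card G) : (fun g => (ρ g).trace) ∈ Irr G := by
  let V : FDRep ℂ G := FDRep.of (V := Fin n → ℂ)
    ((Matrix.toLinAlgEquiv' : Matrix (Fin n) (Fin n) ℂ ≃ₐ[ℂ] _).toMonoidHom.comp ρ)
  have hV : ∀ g, V.character g = (ρ g).trace := fun g => Matrix.trace_toLin'_eq (ρ g)
  refine ⟨V, (FDRep.simple_iff_char_is_norm_one V).mpr ?_, funext fun g => (hV g).symm⟩
  simpa only [hV] using hρ

theorem coe_mem_Irr (f : G →* ℂ) : ⇑f ∈ Irr G := by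
  have h := trace_mem_Irr ((Matrix.scalar (Fin 1)).toMonoidHom.comp f) (by
    have hf : ∀ g, f g * f g⁻¹ = 1 := fun g => by rw [← map_mul, mul_inv_cancel, map_one]
    simp [-map_inv, Matrix.trace, hf])
  simpa [Matrix.trace] using h

end Irreducible

section Duality

variable {A : Type} [Fintype A]

open scoped Classical in
theorem sum_unitsHom [Group A] (f : A →* ℂˣ) :
    ∑ x, (f x : ℂ) = if f = 1 then (Fintype.card A : ℂ) else 0 := by
  have h := sum_hom_units ((Units.coeHom ℂ).comp f)
  have hiff : (Units.coeHom ℂ).comp f = 1 ↔ f = 1 := by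
    simp [MonoidHom.ext_iff]
  simpa [hiff] using h

theorem sum_unitsHom_apply [CommGroup A] [Fintype (A →* ℂˣ)] {x : A} (hx : x ≠ 1) :
    ∑ f : A →* ℂˣ, (f x : ℂ) = 0 := by
  obtain ⟨f, hf⟩ := CommGroup.exists_apply_ne_one_of_hasEnoughRootsOfUnity A ℂ hx
  refine sum_hom_units_eq_zero ((Units.coeHom ℂ).comp (MonoidHom.eval x)) fun h => hf ?_
  simpa using DFunLike.congr_fun h f

end Duality

section Induced

variable {G : Type} [Group G] (K : Subgroup G)

open scoped Classical in
/-- For a subgroup `K` of index two inverted by every element outside `K`, this is the character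
induced from the linear character `f` of `K`. -/
noncomputable def indChar (f : K →* ℂˣ) (g : G) : ℂ :=
  if h : g ∈ K then (f ⟨g, h⟩ : ℂ) + (f ⟨g, h⟩ : ℂ)⁻¹ else 0

variable {K}

theorem indChar_coe (f : K →* ℂˣ) (x : K) : indChar K f x = (f x : ℂ) + (f x : ℂ)⁻¹ := by
  simp [indChar]

theorem indChar_of_notMem (f : K →* ℂˣ) {g : G} (hg : g ∉ K) : indChar K f g = 0 := by
  simp [indChar, hg]

theorem indChar_one (f : K →* ℂˣ) : indChar K f 1 = 2 := by
  have h := indChar_coe f 1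
  norm_num at h
  exact h

theorem indChar_inv (f : K →* ℂˣ) : indChar K f⁻¹ = indChar K f := by
  ext g
  by_cases hg : g ∈ K
  · simp [indChar, hg, add_comm]
  · simp [indChar, hg]

theorem indChar_apply_inv (f : K →* ℂˣ) (g : G) : indChar K f g⁻¹ = indChar K f g := by
  by_cases hg : g ∈ K
  · lift g to K using hg
    rw [← Subgroup.coe_inv, indChar_coe, indChar_coe]
    simp [add_comm]
  · rw [indChar_of_notMem f hg, indChar_of_notMem f (by simpa using hg)]

variable [Fintype K]

theorem sum_mul_indChar [Fintype G] (F : G → ℂ) (f : K →* ℂˣ) :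
    ∑ g, F g * indChar K f g = ∑ x : K, F x * ((f x : ℂ) + (f x : ℂ)⁻¹) := by
  refine (Fintype.sum_of_injective (Subtype.val : K → G) Subtype.val_injective _ _ ?_ ?_).symm
  · intro g hg
    rw [indChar_of_notMem f (by simpa using hg), mul_zero]
  · intro x
    rw [indChar_coe]

open scoped Classical in
theorem sum_indChar_mul_inv (f e : K →* ℂˣ) :
    ∑ x : K, indChar K f x * (e x : ℂ)⁻¹ =
      (if f = e then (Fintype.card K : ℂ) else 0) + if f⁻¹ = e then (Fintype.card K : ℂ) else 0 := by
  have h₁ := sum_unitsHom (f * e⁻¹)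
  have h₂ := sum_unitsHom (f⁻¹ * e⁻¹)
  have hiff₁ : f * e⁻¹ = 1 ↔ f = e := mul_inv_eq_one (a := f)
  have hiff₂ : f⁻¹ * e⁻¹ = 1 ↔ f⁻¹ = e := mul_inv_eq_one (a := f⁻¹)
  simp only [hiff₁, hiff₂] at h₁ h₂
  rw [← h₁, ← h₂, ← Finset.sum_add_distrib]
  refine Finset.sum_congr rfl fun x _ => ?_
  simp [indChar_coe, add_mul]

theorem indChar_eq_iff {f e : K →* ℂˣ} : indChar K f = indChar K e ↔ f = e ∨ f⁻¹ = e := by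
  classical
  refine ⟨fun h => ?_, ?_⟩
  · by_contra! hne
    have hsum := sum_indChar_mul_inv e e
    rw [← h, sum_indChar_mul_inv, if_neg hne.1, if_neg hne.2, if_pos rfl] at hsum
    have hK : (Fintype.card K : ℂ) ≠ 0 := Nat.cast_ne_zero.mpr Fintype.card_ne_zero
    split_ifs at hsum
    · exact hK (by linear_combination -hsum / 2)
    · exact hK (by linear_combination -hsum)
  · rintro (rfl | rfl)
    · rfl
    · rw [indChar_inv]

theorem sum_indChar_mul_indChar_inv [Fintype G] {f : K →* ℂˣ} (hf : f⁻¹ ≠ f) :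
    ∑ g, indChar K f g * indChar K f g⁻¹ = 2 * (Fintype.card K : ℂ) := by
  simp only [indChar_apply_inv]
  rw [sum_mul_indChar]
  have h₁ := sum_indChar_mul_inv f f
  have h₂ := sum_indChar_mul_inv f f⁻¹
  rw [if_pos rfl, if_neg hf] at h₁
  rw [if_pos rfl, if_neg hf.symm] at h₂
  simp only [mul_add, Finset.sum_add_distrib]
  simp only [MonoidHom.inv_apply, Units.val_inv_eq_inv_val, inv_inv] at h₂
  rw [h₁, h₂]
  ring

end Induced

section Inverting

variable {G : Type} [Group G] {K : Subgroup G}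

theorem mul_comm_of_inverting (hK : K ≠ ⊤) (hinv : ∀ g ∉ K, ∀ x ∈ K, g * x * g⁻¹ = x⁻¹) (x y : K) :
    x * y = y * x := by
  obtain ⟨t, ht⟩ : ∃ t, t ∉ K := by
    by_contra! h
    exact hK (Subgroup.eq_top_iff' K |>.mpr h)
  have h := hinv t ht _ (x * y)⁻¹.2
  have hx := hinv t ht _ (x⁻¹).2
  have hy := hinv t ht _ (y⁻¹).2
  ext
  simp only [Subgroup.coe_mul, Subgroup.coe_inv, inv_inv, mul_inv_rev] at h hx hy ⊢
  calc (x : G) * y = t * (y : G)⁻¹ * t⁻¹ * (t * (x : G)⁻¹ * t⁻¹) := by rw [← h]; group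
    _ = y * x := by rw [hx, hy]

theorem sq_eq_one_of_inverting {p : ℕ} (hodd : Odd p) (helem : ∀ x ∈ K, x ^ p = 1)
    (hidx : K.index = 2) (hinv : ∀ g ∉ K, ∀ x ∈ K, g * x * g⁻¹ = x⁻¹) {t : G} (ht : t ∉ K) :
    t * t = 1 := by
  have hmem : t * t ∈ K := Subgroup.mul_self_mem_of_index_two hidx t
  obtain ⟨m, rfl⟩ := hodd
  have h := hinv t ht _ hmem
  have h' : (t * t) * (t * t) = 1 := by
    rw [eq_inv_iff_mul_eq_one] at h
    simpa [mul_assoc] using h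
  have hp := helem _ hmem
  rwa [pow_succ, pow_mul, sq, h', one_pow, one_mul] at hp

theorem inv_ne_self_of_odd {A : Type} [Group A] {p : ℕ} (hodd : Odd p) (helem : ∀ x : A, x ^ p = 1)
    {f : A →* ℂˣ} (hf : f ≠ 1) : f⁻¹ ≠ f := by
  intro h
  obtain ⟨m, rfl⟩ := hodd
  refine hf (MonoidHom.ext fun x => ?_)
  have hsq : f x * f x = 1 := by
    rw [← inv_eq_iff_mul_eq_one]
    exact DFunLike.congr_fun h x
  have hp : f x ^ (2 * m + 1) = 1 := by rw [← map_pow, helem, map_one]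
  rwa [pow_succ, pow_mul, sq, hsq, one_pow, one_mul] at hp

open scoped Classical in
/-- The matrix representation of `G` induced from the linear character `f` of `K`, in the basis
adapted to the involution `t ∉ K`. -/
noncomputable def indRep (hidx : K.index = 2) (hinv : ∀ g ∉ K, ∀ x ∈ K, g * x * g⁻¹ = x⁻¹)
    {t : G} (ht : t ∉ K) (htt : t * t = 1) (f : K →* ℂˣ) : G →* Matrix (Fin 2) (Fin 2) ℂ :=
  have hmem {g : G} (hg : g ∉ K) : g * t ∈ K := by
    simpa [Subgroup.mul_mem_iff_of_index_two hidx, ht] using hg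
  { toFun := fun g =>
      if h : g ∈ K then !![(f ⟨g, h⟩ : ℂ), 0; 0, (f ⟨g, h⟩ : ℂ)⁻¹]
      else !![0, (f ⟨g * t, hmem h⟩ : ℂ); (f ⟨g * t, hmem h⟩ : ℂ)⁻¹, 0]
    map_one' := by
      have h1 : f ⟨1, K.one_mem⟩ = 1 := map_one f
      simp [h1, Matrix.one_fin_two]
    map_mul' := by
      intro a b
      have hti : t⁻¹ = t := inv_eq_of_mul_eq_one_left htt
      by_cases ha : a ∈ K <;> by_cases hb : b ∈ K
      · have hab := K.mul_mem ha hb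
        have key : f ⟨a * b, hab⟩ = f ⟨a, ha⟩ * f ⟨b, hb⟩ := map_mul f ⟨a, ha⟩ ⟨b, hb⟩
        simp [ha, hb, hab, key, mul_comm]
      · have hab : a * b ∉ K := by simp [Subgroup.mul_mem_iff_of_index_two hidx, ha, hb]
        have key : f ⟨a * b * t, hmem hab⟩ = f ⟨a, ha⟩ * f ⟨b * t, hmem hb⟩ := by
          rw [← map_mul]
          congr 1
          ext
          simp [mul_assoc]
        simp [ha, hb, hab, key, mul_comm]
      · have hab : a * b ∉ K := by simp [Subgroup.mul_mem_iff_of_index_two hidx, ha, hb]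
        have key : f ⟨a * b * t, hmem hab⟩ = f ⟨a * t, hmem ha⟩ * (f ⟨b, hb⟩)⁻¹ := by
          rw [← map_inv, ← map_mul]
          congr 1
          ext
          simp only [Subgroup.coe_mul, Subgroup.coe_inv]
          rw [← hinv t ht b hb]
          simp [hti, mul_assoc, ← mul_assoc t t, htt]
        simp [ha, hb, hab, key, mul_comm]
      · have hab : a * b ∈ K := by simp [Subgroup.mul_mem_iff_of_index_two hidx, ha, hb]
        have key : f ⟨a * b, hab⟩ = f ⟨a * t, hmem ha⟩ * (f ⟨b * t, hmem hb⟩)⁻¹ := by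
          rw [← map_inv, ← map_mul]
          congr 1
          ext
          simp only [Subgroup.coe_mul, Subgroup.coe_inv]
          rw [← hinv t ht _ (hmem hb)]
          simp [mul_assoc, ← mul_assoc t t, htt]
        simp [ha, hb, hab, key, mul_comm] }

theorem trace_indRep (hidx : K.index = 2) (hinv : ∀ g ∉ K, ∀ x ∈ K, g * x * g⁻¹ = x⁻¹)
    {t : G} (ht : t ∉ K) (htt : t * t = 1) (f : K →* ℂˣ) (g : G) :
    (indRep hidx hinv ht htt f g).trace = indChar K f g := by
  by_cases hg : g ∈ K <;> simp [indRep, indChar, hg, Matrix.trace_fin_two]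

theorem indChar_mem_Irr [Fintype G] {p : ℕ} (hodd : Odd p) (helem : ∀ x ∈ K, x ^ p = 1)
    (hidx : K.index = 2) (hinv : ∀ g ∉ K, ∀ x ∈ K, g * x * g⁻¹ = x⁻¹) {f : K →* ℂˣ} (hf : f ≠ 1) :
    indChar K f ∈ Irr G := by
  classical
  obtain ⟨t, ht⟩ : ∃ t, t ∉ K := by
    by_contra! h
    simp [(Subgroup.eq_top_iff' K).mpr h] at hidx
  have htt := sq_eq_one_of_inverting hodd helem hidx hinv ht
  have hne : f⁻¹ ≠ f := inv_ne_self_of_odd hodd (fun x => Subtype.ext (helem x x.2)) hf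
  have h := trace_mem_Irr (indRep hidx hinv ht htt f) (by
    simp only [trace_indRep]
    rw [sum_indChar_mul_indChar_inv hne, ← K.card_mul_index, hidx, Nat.card_eq_fintype_card]
    push_cast
    ring)
  simpa only [trace_indRep] using h

open scoped Classical in
/-- The sign character of `G` with kernel the subgroup `K` of index two. -/
noncomputable def indexTwoSign (hidx : K.index = 2) : G →* ℂ where
  toFun g := if g ∈ K then 1 else -1
  map_one' := by simp
  map_mul' a b := by
    by_cases ha : a ∈ K <;> by_cases hb : b ∈ K <;>
      simp [Subgroup.mul_mem_iff_of_index_two hidx, ha, hb]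

theorem indChar_one_hom (hidx : K.index = 2) (g : G) :
    indChar K 1 g = (1 : G →* ℂ) g + indexTwoSign hidx g := by
  by_cases hg : g ∈ K <;> simp [indChar, indexTwoSign, hg]

theorem Irr_eq [Fintype G] {p : ℕ} (hodd : Odd p) (helem : ∀ x ∈ K, x ^ p = 1)
    (hidx : K.index = 2) (hinv : ∀ g ∉ K, ∀ x ∈ K, g * x * g⁻¹ = x⁻¹) :
    Irr G = {⇑(1 : G →* ℂ), ⇑(indexTwoSign hidx)} ∪ indChar K '' {f | f ≠ 1} := by
  classical
  refine Set.Subset.antisymm (fun χ hχ => ?_) ?_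
  · by_contra hnot
    simp only [Set.mem_union, Set.mem_insert_iff, Set.mem_singleton_iff, Set.mem_image,
      Set.mem_ofPred_eq, not_or, not_exists, not_and] at hnot
    obtain ⟨⟨hone, hsign⟩, hind⟩ := hnot
    have horth : ∀ f : K →* ℂˣ, ∑ x : K, χ x * ((f x : ℂ) + (f x : ℂ)⁻¹) = 0 := by
      intro f
      rw [← sum_mul_indChar]
      rw [Finset.sum_congr rfl fun g _ => congrArg (χ g * ·) (indChar_apply_inv f g).symm]
      by_cases hf : f = 1
      · subst hf
        simp only [indChar_one_hom hidx, mul_add, Finset.sum_add_distrib]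
        rw [sum_mul_inv_eq_zero_of_mem_Irr hχ (coe_mem_Irr _) hone,
          sum_mul_inv_eq_zero_of_mem_Irr hχ (coe_mem_Irr _) hsign, add_zero]
      · exact sum_mul_inv_eq_zero_of_mem_Irr hχ (indChar_mem_Irr hodd helem hidx hinv hf)
          (Ne.symm (hind f hf))
    have hK : K ≠ ⊤ := by
      rintro rfl
      simp at hidx
    let _ : CommGroup K := { (inferInstance : Group K) with
      mul_comm := mul_comm_of_inverting hK hinv }
    let _ : Fintype (K →* ℂˣ) := Fintype.ofFinite _
    have hsum : ∑ x : K, χ x * ∑ f : K →* ℂˣ, ((f x : ℂ) + (f x : ℂ)⁻¹) = 0 := by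
      simp only [Finset.mul_sum]
      rw [Finset.sum_comm]
      exact Finset.sum_eq_zero fun f _ => horth f
    rw [Finset.sum_eq_single 1] at hsum
    · have h1 := apply_one_ne_zero_of_mem_Irr hχ
      simp [h1] at hsum
    · intro x _ hx
      have hx' := sum_unitsHom_apply (inv_ne_one.mpr hx)
      simp only [map_inv, Units.val_inv_eq_inv_val] at hx'
      rw [Finset.sum_add_distrib, sum_unitsHom_apply hx, hx', add_zero, mul_zero]
    · simp
  · rintro χ ((rfl | rfl) | ⟨f, hf, rfl⟩)
    · exact coe_mem_Irr _
    · exact coe_mem_Irr _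
    · exact indChar_mem_Irr hodd helem hidx hinv hf

theorem ncard_indChar_image [Fintype G] {p : ℕ} (hodd : Odd p) (helem : ∀ x ∈ K, x ^ p = 1)
    (hK : K ≠ ⊤) (hinv : ∀ g ∉ K, ∀ x ∈ K, g * x * g⁻¹ = x⁻¹) :
    (indChar K '' {f | f ≠ 1}).ncard = (Nat.card K - 1) / 2 := by
  classical
  let _ : CommGroup K := { (inferInstance : Group K) with
    mul_comm := mul_comm_of_inverting hK hinv }
  let _ : Fintype (K →* ℂˣ) := Fintype.ofFinite _
  let s : Finset (K →* ℂˣ) := Finset.univ.erase 1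
  have hs : s.card = Nat.card K - 1 := by
    rw [Finset.card_erase_of_mem (Finset.mem_univ _), Finset.card_univ, ← Nat.card_eq_fintype_card,
      CommGroup.card_monoidHom_of_hasEnoughRootsOfUnity]
  have himage : indChar K '' {f | f ≠ 1} = (s.image (indChar K) : Finset (G → ℂ)) := by
    simp [s, Set.ext_iff]
  have hfiber : ∀ χ ∈ s.image (indChar K), (s.filter fun e => indChar K e = χ).card = 2 := by
    intro χ hχ
    obtain ⟨f, hf, rfl⟩ := Finset.mem_image.mp hχ
    have hf1 : f ≠ 1 := Finset.ne_of_mem_erase hf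
    rw [Finset.card_eq_two]
    refine ⟨f, f⁻¹, (inv_ne_self_of_odd hodd (fun x => Subtype.ext (helem x x.2)) hf1).symm, ?_⟩
    ext e
    simp only [s, Finset.mem_filter, Finset.mem_erase, Finset.mem_univ, and_true,
      Finset.mem_insert, Finset.mem_singleton, indChar_eq_iff, inv_eq_iff_eq_inv (a := e)]
    refine ⟨fun h => h.2, fun h => ⟨?_, h⟩⟩
    rintro rfl
    rcases h with h | h
    · exact hf1 h.symm
    · exact hf1 (inv_eq_one (a := f) |>.mp h.symm)
  have hcount := Finset.card_eq_sum_card_image (indChar K) s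
  rw [Finset.sum_congr rfl hfiber, Finset.sum_const, smul_eq_mul] at hcount
  rw [himage, Set.ncard_coe_finset, ← hs, hcount, Nat.mul_div_cancel _ two_pos]

theorem kerSet_indChar (f : K →* ℂˣ) : kerSet G (indChar K f) = Subtype.val '' (f.ker : Set K) := by
  ext g
  simp only [kerSet, Set.mem_ofPred_eq, indChar_one]
  by_cases hg : g ∈ K
  · lift g to K using hg
    have h0 : (f g : ℂ) ≠ 0 := (f g).ne_zero
    rw [indChar_coe, Subtype.val_injective.mem_set_image, SetLike.mem_coe, MonoidHom.mem_ker,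
      ← Units.val_eq_one]
    refine ⟨fun h => ?_, fun h => by rw [h]; norm_num⟩
    field_simp at h
    have hsq : ((f g : ℂ) - 1) ^ 2 = 0 := by linear_combination h
    exact sub_eq_zero.mp (pow_eq_zero_iff two_ne_zero |>.mp hsq)
  · rw [indChar_of_notMem f hg]
    simp [hg]

theorem card_ker_mul_eq {A : Type} [Group A] {p : ℕ} (hp : p.Prime)
    (helem : ∀ x : A, x ^ p = 1) {f : A →* ℂˣ} (hf : f ≠ 1) : Nat.card f.ker * p = Nat.card A := by
  have : NeZero p := ⟨hp.ne_zero⟩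
  have hle : f.range ≤ rootsOfUnity p ℂ := by
    rintro _ ⟨x, rfl⟩
    rw [mem_rootsOfUnity, ← map_pow, helem, map_one]
  have hdvd := Subgroup.card_dvd_of_le hle
  rw [Complex.card_rootsOfUnity] at hdvd
  have hrange : Nat.card f.range = p := by
    refine (hp.eq_one_or_self_of_dvd _ hdvd).resolve_left fun h => hf ?_
    rwa [Subgroup.card_eq_one, MonoidHom.range_eq_bot_iff] at h
  rw [← f.ker.card_mul_index, Subgroup.index_ker, hrange]

theorem cod_indChar [Fintype G] {p : ℕ} (hp : p.Prime) (helem : ∀ x ∈ K, x ^ p = 1)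
    (hidx : K.index = 2) {f : K →* ℂˣ} (hf : f ≠ 1) : cod G (indChar K f) = p := by
  have hker := card_ker_mul_eq hp (fun x : K => Subtype.ext (helem x x.2)) hf
  have hpos : 0 < Nat.card f.ker := Nat.card_pos
  rw [cod, kerSet_indChar, Set.ncard_image_of_injective _ Subtype.val_injective, charDeg,
    indChar_one, ← Nat.card_eq_fintype_card, ← K.card_mul_index, hidx, ← hker, mul_assoc,
    ← Nat.card_coe_set_eq, SetLike.coe_sort_coe, Nat.mul_div_cancel_left _ hpos]
  simp

theorem charDeg_indChar (f : K →* ℂˣ) : charDeg G (indChar K f) = 2 := by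
  simp [charDeg, indChar_one]

theorem charDeg_coe (f : G →* ℂ) : charDeg G f = 1 := by
  simp [charDeg]

theorem cod_one [Fintype G] : cod G ⇑(1 : G →* ℂ) = 1 := by
  have : kerSet G ⇑(1 : G →* ℂ) = Set.univ := by simp [kerSet]
  rw [cod, charDeg_coe, this, Set.ncard_univ, Nat.card_eq_fintype_card,
    Nat.div_self Fintype.card_pos]

theorem cod_indexTwoSign [Fintype G] (hidx : K.index = 2) : cod G (indexTwoSign hidx) = 2 := by
  have hker : kerSet G (indexTwoSign hidx) = K := by
    ext g
    by_cases hg : g ∈ K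
    · simp [kerSet, indexTwoSign, hg]
    · norm_num [kerSet, indexTwoSign, hg]
  rw [cod, charDeg_coe, hker, ← Nat.card_eq_fintype_card, ← K.card_mul_index, hidx,
    ← Nat.card_coe_set_eq]
  simp

end Inverting

/-- The Frobenius group `C_p^β ⋊ C₂` (inversion action) has exactly
`(p^β - 1)/2` nonlinear irreducible characters, all of degree 2 and codegree
`p`, exactly two linear characters, and is a `T'_{(p^β - 1)/2}`-group. -/
theorem frobenius_pBeta_c2 (G : Type) [Group G] [Fintype G] (p β : ℕ)
    (hp : p.Prime) (hodd : Odd p) (hβ : 1 ≤ β) (K : Subgroup G) (hn : K.Normal)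
    (helem : ∀ x ∈ K, x ^ p = 1) (hcard : Nat.card K = p ^ β)
    (hidx : K.index = 2)
    (hinv : ∀ g ∉ K, ∀ x ∈ K, g * x * g⁻¹ = x⁻¹) :
    {χ ∈ Irr G | charDeg G χ ≠ 1}.ncard = (p ^ β - 1) / 2 ∧
    (∀ χ ∈ Irr G, charDeg G χ ≠ 1 → charDeg G χ = 2 ∧ cod G χ = p) ∧
    {χ ∈ Irr G | charDeg G χ = 1}.ncard = 2 ∧
    IsTk' G ((p ^ β - 1) / 2) := by
  have hK : K ≠ ⊤ := by
    rintro rfl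
    simp at hidx
  have hp2 : p ≠ 2 := by
    rintro rfl
    exact absurd hodd (by decide)
  have hIrr := Irr_eq hodd helem hidx hinv
  have hcount := ncard_indChar_image hodd helem hK hinv
  rw [hcard] at hcount
  have hnonlinear : {χ ∈ Irr G | charDeg G χ ≠ 1} = indChar K '' {f | f ≠ 1} := by
    ext χ
    rw [hIrr]
    constructor
    · rintro ⟨(rfl | rfl) | h, hχ⟩
      · exact absurd (charDeg_coe _) hχ
      · exact absurd (charDeg_coe _) hχ
      · exact h
    · rintro ⟨f, hf, rfl⟩
      exact ⟨Or.inr ⟨f, hf, rfl⟩, by simp [charDeg_indChar]⟩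
  have hlinear : {χ ∈ Irr G | charDeg G χ = 1} = {⇑(1 : G →* ℂ), ⇑(indexTwoSign hidx)} := by
    ext χ
    rw [hIrr]
    constructor
    · rintro ⟨h | ⟨f, hf, rfl⟩, hχ⟩
      · exact h
      · simp [charDeg_indChar] at hχ
    · rintro (rfl | rfl)
      · exact ⟨Or.inl (Or.inl rfl), charDeg_coe _⟩
      · exact ⟨Or.inl (Or.inr rfl), charDeg_coe _⟩
  have hcod : ∀ f : K →* ℂˣ, f ≠ 1 → cod G (indChar K f) = p := fun f hf =>
    cod_indChar hp helem hidx hf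
  have hne : ⇑(1 : G →* ℂ) ≠ ⇑(indexTwoSign hidx) := fun h => by
    have := congrArg (cod G) h
    rw [cod_one, cod_indexTwoSign] at this
    omega
  have hpmult : {χ ∈ Irr G | cod G χ = p} = indChar K '' {f | f ≠ 1} := by
    ext χ
    rw [hIrr]
    constructor
    · rintro ⟨(rfl | rfl) | h, hχ⟩
      · exact absurd (cod_one.symm.trans hχ).symm hp.ne_one
      · exact absurd ((cod_indexTwoSign hidx).symm.trans hχ).symm hp2
      · exact h
    · rintro ⟨f, hf, rfl⟩
      exact ⟨Or.inr ⟨f, hf, rfl⟩, hcod f hf⟩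
  have hpow : 3 ≤ p ^ β :=
    (show 3 ≤ p by have := hp.two_le; omega).trans (Nat.le_self_pow (by omega) p)
  refine ⟨by rw [hnonlinear, hcount], ?_, by rw [hlinear, Set.ncard_pair hne], p, ?_, ?_, ?_⟩
  · intro χ hχ hdeg
    obtain ⟨f, hf, rfl⟩ := hnonlinear.subset ⟨hχ, hdeg⟩
    exact ⟨charDeg_indChar f, hcod f hf⟩
  · obtain ⟨χ, hχ⟩ := Set.nonempty_of_ncard_ne_zero
      (show (indChar K '' {f | f ≠ 1}).ncard ≠ 0 by omega)
    obtain ⟨hmem, hχp⟩ := hpmult.superset hχ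
    exact ⟨χ, hmem, hχp⟩
  · rw [codMult, hpmult, hcount]
  · rintro d ⟨χ, hχ, rfl⟩ hd
    rw [codMult, Set.ncard_eq_one]
    refine ⟨χ, Set.eq_singleton_iff_unique_mem.mpr ⟨⟨hχ, rfl⟩, ?_⟩⟩
    rintro φ ⟨hφ, hφχ⟩
    rw [hIrr] at hχ hφ
    rcases hχ with (rfl | rfl) | ⟨f, hf, rfl⟩
    · rcases hφ with (rfl | rfl) | ⟨e, he, rfl⟩
      · rfl
      · rw [cod_one, cod_indexTwoSign] at hφχ
        omega
      · exact absurd (hφχ.symm.trans (hcod e he)) hd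
    · rcases hφ with (rfl | rfl) | ⟨e, he, rfl⟩
      · rw [cod_one, cod_indexTwoSign] at hφχ
        omega
      · rfl
      · exact absurd (hφχ.symm.trans (hcod e he)) hd
    · exact absurd (hcod f hf) hd
end

section
/- Let β ≥ 2 be such that p = 2^β − 1 is prime, and let G = C₂^β ⋊ C_p be the Frobenius group where C_p acts fixed-point-freely on C₂^β. Then G has a unique nonlinear irreducible character, its p − 1 nontrivial linear characters all have codegree p, and G is a T'_{p−1}-group. -/
open CategoryTheory

/-- If conjugation by `g` fixes no nontrivial element of the normal subgroup `K`, then every element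
of the coset `K g` is conjugate to `g`. -/
lemma exists_conj_eq_mul {G : Type*} [Group G] [Finite G] (K : Subgroup G) (hn : K.Normal)
    (hfrob : ∀ g : G, g ∉ K → ∀ x ∈ K, x ≠ 1 → g * x * g⁻¹ ≠ x)
    {g y : G} (hg : g ∉ K) (hy : y ∈ K) : ∃ x ∈ K, x * g * x⁻¹ = y * g := by
  let φ : K → K := fun x => ⟨x * (g * x⁻¹ * g⁻¹),
    K.mul_mem x.2 (hn.conj_mem _ (K.inv_mem x.2) g)⟩
  have hφ : Function.Injective φ := by
    intro a b hab
    have h : (a : G) * (g * (a : G)⁻¹ * g⁻¹) = b * (g * (b : G)⁻¹ * g⁻¹) := congrArg Subtype.val hab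
    by_contra hne
    refine hfrob g hg ((b : G)⁻¹ * a) (K.mul_mem (K.inv_mem b.2) a.2) ?_ ?_
    · intro h1
      exact hne (Subtype.ext (inv_mul_eq_one.mp h1).symm)
    · have h2 : (b : G)⁻¹ * a = g * (b : G)⁻¹ * g⁻¹ * (g * (a : G)⁻¹ * g⁻¹)⁻¹ := by
        rw [eq_mul_inv_iff_mul_eq, mul_assoc, h, inv_mul_cancel_left]
      exact Eq.trans (by group) h2.symm
  obtain ⟨x, hx⟩ := (Finite.injective_iff_surjective.mp hφ) ⟨y, hy⟩
  refine ⟨x, x.2, ?_⟩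
  have : (x : G) * (g * (x : G)⁻¹ * g⁻¹) = y := congrArg Subtype.val hx
  rw [← this]
  group

/-- A count of cosets shows that `G` permutes the nontrivial elements of `K` transitively. -/
lemma exists_conj_eq {G : Type*} [Group G] [Finite G] (K : Subgroup G) (hn : K.Normal)
    (hcomm : ∀ x ∈ K, ∀ y ∈ K, x * y = y * x)
    (hcard : Nat.card K = K.index + 1)
    (hfrob : ∀ g : G, g ∉ K → ∀ x ∈ K, x ≠ 1 → g * x * g⁻¹ ≠ x)
    {x y : G} (hx : x ∈ K) (hx1 : x ≠ 1) (hy : y ∈ K) (hy1 : y ≠ 1) :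
    ∃ g : G, g * x * g⁻¹ = y := by
  let φ : G ⧸ K → {z : K // z ≠ 1} := Quotient.lift
    (fun g => ⟨⟨g * x * g⁻¹, hn.conj_mem x hx g⟩, fun h => hx1 (by
      simpa using congrArg Subtype.val h)⟩) (by
      intro a b hab
      have hab : a⁻¹ * b ∈ K := QuotientGroup.leftRel_apply.mp hab
      have := hcomm _ hab _ hx
      refine Subtype.ext (Subtype.ext ?_)
      change a * x * a⁻¹ = b * x * b⁻¹
      calc a * x * a⁻¹ = a * (x * (a⁻¹ * b)) * b⁻¹ := by group
        _ = b * x * b⁻¹ := by rw [← this]; group)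
  have hφ : Function.Injective φ := by
    intro a b
    induction a using QuotientGroup.induction_on with | H a => ?_
    induction b using QuotientGroup.induction_on with | H b => ?_
    intro h
    have h : a * x * a⁻¹ = b * x * b⁻¹ := congrArg (fun z : {z : K // z ≠ 1} => (z.1 : G)) h
    rw [QuotientGroup.eq]
    by_contra hab
    refine hfrob _ hab x hx hx1 ?_
    calc a⁻¹ * b * x * (a⁻¹ * b)⁻¹ = a⁻¹ * (b * x * b⁻¹) * a := by group
      _ = x := by rw [← h]; group
  have hc : Nat.card {z : K // z ≠ 1} ≤ Nat.card (G ⧸ K) := by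
    have h1 : Nat.card {z : K // z ≠ 1} + 1 = Nat.card K := by
      classical
      have := Fintype.ofFinite K
      rw [Nat.card_eq_fintype_card, Nat.card_eq_fintype_card, Fintype.card_subtype_compl]
      have : 0 < Fintype.card K := Fintype.card_pos
      simp; omega
    have : Nat.card (G ⧸ K) = K.index := rfl
    omega
  obtain ⟨g, hg⟩ := (hφ.bijective_of_nat_card_le hc).2
    ⟨⟨y, hy⟩, fun h => hy1 (congrArg Subtype.val h)⟩
  induction g using QuotientGroup.induction_on with | H g => ?_
  exact ⟨g, congrArg (fun z : {z : K // z ≠ 1} => (z.1 : G)) hg⟩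


lemma simple_iff_finrank_invariants_linHom_eq_one {G : Type} [Group G] [Finite G] (V : FDRep ℂ G) :
    Simple V ↔ Module.finrank ℂ (Representation.linHom V.ρ V.ρ).invariants = 1 := by
  rw [FDRep.simple_iff_end_is_rank_one,
    (Representation.linHom.invariantsEquivFDRepHom V V).finrank_eq]

lemma finrank_ne_zero_of_simple {G : Type} [Group G] [Finite G] (V : FDRep ℂ G) [hV : Simple V] :
    Module.finrank ℂ V ≠ 0 := by
  intro h
  have := Module.finrank_zero_iff.mp h
  rw [simple_iff_finrank_invariants_linHom_eq_one, Module.finrank_zero_of_subsingleton] at hV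
  exact zero_ne_one hV

/-- Schur's lemma. -/
lemma exists_eq_smul_one_of_simple {G : Type} [Group G] [Finite G] (V : FDRep ℂ G)
    [hV : Simple V] (T : Module.End ℂ V) (hT : ∀ g, T * V.ρ g = V.ρ g * T) :
    ∃ c : ℂ, T = c • 1 := by
  have h0 := finrank_ne_zero_of_simple V
  have : Nontrivial V := Module.nontrivial_of_finrank_pos (Nat.pos_of_ne_zero h0)
  rw [simple_iff_finrank_invariants_linHom_eq_one] at hV
  have key : ∀ S : Module.End ℂ V, (∀ g, S * V.ρ g = V.ρ g * S) →
      S ∈ (Representation.linHom V.ρ V.ρ).invariants := by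
    intro S hS g
    change V.ρ g * (S * V.ρ g⁻¹) = S
    rw [hS, ← mul_assoc, ← map_mul, mul_inv_cancel, map_one, one_mul]
  have h1 : (⟨1, key 1 (by simp)⟩ : (Representation.linHom V.ρ V.ρ).invariants) ≠ 0 := by
    intro h
    exact one_ne_zero (congrArg Subtype.val h)
  obtain ⟨c, hc⟩ := (finrank_eq_one_iff_of_nonzero' _ h1).mp hV ⟨T, key T hT⟩
  exact ⟨c, (congrArg Subtype.val hc).symm⟩

lemma finrank_eq_one_of_commute {G : Type} [Group G] [Finite G] (V : FDRep ℂ G)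
    [Simple V] (h : ∀ a b, V.ρ a * V.ρ b = V.ρ b * V.ρ a) : Module.finrank ℂ V = 1 := by
  have hs : ∀ T : Module.End ℂ V, ∃ c : ℂ, c • (1 : Module.End ℂ V) = T := by
    intro T
    obtain ⟨c, hc⟩ := exists_eq_smul_one_of_simple V T (by
      intro g
      obtain ⟨c, hc⟩ := exists_eq_smul_one_of_simple V (V.ρ g) (h g)
      simp [hc])
    exact ⟨c, hc.symm⟩
  have h1 := finrank_le_one _ hs
  have h0 := finrank_ne_zero_of_simple V
  rw [Module.finrank_linearMap] at h1
  have := Nat.mul_le_mul_left (Module.finrank ℂ V) (Nat.one_le_iff_ne_zero.mpr h0)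
  omega

lemma trivial_or_sum_eq_zero_of_simple {G : Type} [Group G] [Finite G] (V : FDRep ℂ G)
    [Simple V] (K : Subgroup G) [Fintype K] (hn : K.Normal) :
    (∀ y ∈ K, V.ρ y = 1) ∨ ∑ x : K, V.ρ x = 0 := by
  obtain ⟨c, hc⟩ := exists_eq_smul_one_of_simple V (∑ x : K, V.ρ x) (by
    intro g
    rw [Finset.sum_mul, Finset.mul_sum]
    refine Fintype.sum_equiv (MulAut.conjNormal g⁻¹).toEquiv _ _ fun x => ?_
    rw [← map_mul, ← map_mul]
    congr 1
    simp [mul_assoc])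
  by_cases h : c = 0
  · right; simp [hc, h]
  left
  intro y hy
  have h1 : V.ρ y * ∑ x : K, V.ρ x = ∑ x : K, V.ρ x := by
    rw [Finset.mul_sum]
    refine Fintype.sum_equiv (Equiv.mulLeft ⟨y, hy⟩) _ _ fun x => ?_
    rw [← map_mul]; rfl
  rw [hc, mul_smul_comm, mul_one] at h1
  exact smul_right_injective _ h h1

lemma simple_of_ofModule' {G : Type} [Group G] [Finite G] (N : Type) [AddCommGroup N]
    [Module ℂ N] [FiniteDimensional ℂ N] [Module (MonoidAlgebra ℂ G) N]
    [IsScalarTower ℂ (MonoidAlgebra ℂ G) N] [IsSimpleModule (MonoidAlgebra ℂ G) N] :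
    Simple (FDRep.of (Representation.ofModule' (k := ℂ) (G := G) N)) := by
  have := IsSimpleModule.nontrivial (MonoidAlgebra ℂ G) N
  rw [simple_iff_finrank_invariants_linHom_eq_one]
  change Module.finrank ℂ (Representation.linHom (Representation.ofModule' (k := ℂ) (G := G) N)
    (Representation.ofModule' (k := ℂ) (G := G) N)).invariants = 1
  set ρ := Representation.ofModule' (k := ℂ) (G := G) N
  have hρ : ∀ g v, ρ g v = MonoidAlgebra.single g (1 : ℂ) • v := fun g v => rfl
  have h1 : (⟨LinearMap.id, fun g => by ext v; simp⟩ : (ρ.linHom ρ).invariants) ≠ 0 := by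
    intro h
    obtain ⟨v, hv⟩ := exists_ne (0 : N)
    exact hv (LinearMap.congr_fun (congrArg Subtype.val h) v)
  refine (finrank_eq_one_iff_of_nonzero' _ h1).mpr ?_
  rintro ⟨T, hT⟩
  have hcomm : ∀ (g : G) (v : N), T (MonoidAlgebra.single g (1 : ℂ) • v) =
      MonoidAlgebra.single g (1 : ℂ) • T v := by
    intro g v
    have := LinearMap.congr_fun (hT g) (ρ g v)
    rw [Representation.linHom_apply] at this
    simpa [hρ, smul_smul, MonoidAlgebra.single_mul_single, ← MonoidAlgebra.one_def] using this.symm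
  obtain ⟨c, hc⟩ := (IsSimpleModule.algebraMap_end_bijective_of_isAlgClosed
    (A := MonoidAlgebra ℂ G) (V := N) ℂ).2 (MonoidAlgebra.equivariantOfLinearOfComm T hcomm)
  refine ⟨c, Subtype.ext (LinearMap.ext fun v => ?_)⟩
  exact LinearMap.congr_fun hc v

lemma exists_simple_ρ_ne_one {G : Type} [Group G] [Finite G] {x : G} (hx : x ≠ 1) :
    ∃ V : FDRep ℂ G, Simple V ∧ V.ρ x ≠ 1 := by
  have : NeZero (Nat.card G : ℂ) := ⟨Nat.cast_ne_zero.mpr Nat.card_pos.ne'⟩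
  by_contra! h
  have hN : ∀ N : Submodule (MonoidAlgebra ℂ G) (MonoidAlgebra ℂ G),
      IsSimpleModule (MonoidAlgebra ℂ G) N → ∀ m ∈ N, MonoidAlgebra.of ℂ G x * m = m := by
    intro N hN m hm
    have : FiniteDimensional ℂ N := Module.Finite.trans (MonoidAlgebra ℂ G) N
    have hx := h _ (simple_of_ofModule' (G := G) N)
    exact congrArg Subtype.val (LinearMap.congr_fun hx (⟨m, hm⟩ : N))
  have h1 : (1 : MonoidAlgebra ℂ G) ∈
      sSup {m : Submodule (MonoidAlgebra ℂ G) (MonoidAlgebra ℂ G) |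
        IsSimpleModule (MonoidAlgebra ℂ G) m} := by
    rw [IsSemisimpleModule.sSup_simples_eq_top]; trivial
  rw [sSup_eq_iSup'] at h1
  have h2 : MonoidAlgebra.of ℂ G x * 1 = 1 :=
    Submodule.iSup_induction _ (motive := fun m => MonoidAlgebra.of ℂ G x * m = m) h1
      (fun N m hm => hN N N.2 m hm) (mul_zero _) (fun a b ha hb => by rw [mul_add, ha, hb])
  rw [mul_one, ← map_one (MonoidAlgebra.of ℂ G)] at h2
  exact hx (MonoidAlgebra.of_injective h2)

lemma exists_simple_character_eq_monoidHom {G : Type} [Group G] [Finite G] (f : G →* ℂˣ) :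
    ∃ V : FDRep ℂ G, Simple V ∧ ∀ g, (f g : ℂ) = V.character g := by
  let ρ : Representation ℂ G ℂ :=
    (Algebra.lmul ℂ ℂ).toRingHom.toMonoidHom.comp ((Units.coeHom ℂ).comp f)
  have hc : ∀ g, (FDRep.of ρ).character g = f g := by
    intro g
    have : ρ g = (f g : ℂ) • (1 : Module.End ℂ ℂ) := by
      ext
      simp [ρ]
    change LinearMap.trace ℂ ℂ (ρ g) = _
    simp [this]
  have := Fintype.ofFinite G
  refine ⟨FDRep.of ρ, ?_, fun g => (hc g).symm⟩
  rw [FDRep.simple_iff_char_is_norm_one]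
  simp [hc]

lemma exists_monoidHom_eq_character {G : Type} [Group G] (V : FDRep ℂ G)
    (h : Module.finrank ℂ V = 1) : ∃ f : G →* ℂˣ, ∀ g, V.character g = f g := by
  have hs : ∀ T : Module.End ℂ V, T = LinearMap.trace ℂ V T • 1 := by
    intro T
    have h2 : Module.finrank ℂ (Module.End ℂ V) = 1 := by simp [Module.finrank_linearMap, h]
    have : Nontrivial V := Module.nontrivial_of_finrank_pos (R := ℂ) (by omega)
    obtain ⟨c, hc⟩ := (finrank_eq_one_iff_of_nonzero' (1 : Module.End ℂ V) one_ne_zero).mp h2 T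
    rw [← hc]
    simp [h]
  let f : G →* ℂ :=
    { toFun := V.character
      map_one' := by simp [h]
      map_mul' := by
        intro a b
        simp only [FDRep.character, map_mul]
        rw [hs (V.ρ a)]
        simp [h] }
  exact ⟨f.toHomUnits, fun g => rfl⟩
/-- The values of the nonlinear irreducible character of a Frobenius group with kernel `K` whose
complement acts transitively on the nontrivial elements of `K`. -/
noncomputable def nonlinearChar {G : Type} [Group G] (K : Subgroup G) : G → ℂ :=
  open Classical in fun g => if g = 1 then (K.index : ℂ) else if g ∈ K then -1 else 0

lemma character_eq_nonlinearChar {G : Type} [Group G] [Fintype G] (K : Subgroup G)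
    (hn : K.Normal) (helem : ∀ x ∈ K, x ^ 2 = 1) (hcard : Nat.card K = K.index + 1)
    (hfrob : ∀ g : G, g ∉ K → ∀ x ∈ K, x ≠ 1 → g * x * g⁻¹ ≠ x)
    (V : FDRep ℂ G) (hV : Simple V) (hK : ∃ y ∈ K, V.ρ y ≠ 1) :
    V.character = nonlinearChar K := by
  classical
  have hp : K.index ≠ 0 := Subgroup.index_ne_zero_of_finite
  have hinv : ∀ x ∈ K, x⁻¹ = x := fun x hx =>
    inv_eq_of_mul_eq_one_left (by rw [← pow_two, helem x hx])
  have hcomm : ∀ x ∈ K, ∀ y ∈ K, x * y = y * x := fun x hx y hy => by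
    rw [← hinv _ (K.mul_mem hx hy), mul_inv_rev, hinv x hx, hinv y hy]
  have hsum : ∑ x : K, V.ρ x = 0 := (trivial_or_sum_eq_zero_of_simple V K hn).resolve_left
    (fun h => by obtain ⟨y, hy, hy'⟩ := hK; exact hy' (h y hy))
  have htr : ∀ g, ∑ x : K, V.character (x * g) = 0 := by
    intro g
    simp only [FDRep.character, map_mul]
    rw [← map_sum, ← Finset.sum_mul, hsum, zero_mul, map_zero]
  have hout : ∀ g ∉ K, V.character g = 0 := by
    intro g hg
    have h := htr g
    have hc : ∀ x : K, V.character (x * g) = V.character g := by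
      intro x
      obtain ⟨y, -, hy⟩ := exists_conj_eq_mul K hn hfrob hg x.2
      rw [← hy, FDRep.char_conj]
    simpa [hc] using h
  obtain ⟨x₀, hx₀, hx₀1⟩ : ∃ x ∈ K, x ≠ 1 := by
    obtain ⟨y, hy, hy'⟩ := hK
    exact ⟨y, hy, fun h => hy' (by rw [h, map_one])⟩
  set c := V.character x₀
  set n := Module.finrank ℂ V
  have hin : ∀ x : K, V.character x = if x = 1 then (n : ℂ) else c := by
    intro x
    split_ifs with hx
    · rw [hx, Subgroup.coe_one, FDRep.char_one]
    · obtain ⟨g, hg⟩ := exists_conj_eq K hn hcomm hcard hfrob hx₀ hx₀1 x.2 (by simpa using hx)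
      rw [← hg, FDRep.char_conj]
  have hK1 : Fintype.card K = K.index + 1 := by rw [← Nat.card_eq_fintype_card, hcard]
  have hsumK : ∀ a b : ℂ, ∑ x : K, (if x = 1 then a else b) = a + K.index * b := by
    intro a b
    rw [← Finset.add_sum_erase _ _ (Finset.mem_univ (1 : K)), if_pos rfl,
      Finset.sum_congr rfl (fun x hx => if_neg (Finset.ne_of_mem_erase hx))]
    simp [hK1]
  have h1 : (n : ℂ) + K.index * c = 0 := by
    have := htr 1
    simp only [mul_one, hin, hsumK] at this
    exact this
  have h2 : (n : ℂ) ^ 2 + K.index * c ^ 2 = K.index * (K.index + 1) := by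
    have h := (FDRep.simple_iff_char_is_norm_one V).mp hV
    have h3 : ∑ g : G, V.character g * V.character g⁻¹ =
        ∑ x : K, V.character x * V.character (x : G)⁻¹ := by
      rw [← Finset.sum_subtype (Finset.univ.filter (· ∈ K)) (by simp)
        (fun g => V.character g * V.character g⁻¹)]
      exact (Finset.sum_subset (Finset.subset_univ _) (fun g _ hg => by
        rw [hout g (by simpa using hg), zero_mul])).symm
    have h4 : ∀ x : K, V.character x * V.character (x : G)⁻¹ =
        if x = 1 then (n : ℂ) ^ 2 else c ^ 2 := by
      intro x
      rw [hinv x x.2, hin]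
      split_ifs <;> ring
    rw [h3, Finset.sum_congr rfl (fun x _ => h4 x), hsumK, ← K.index_mul_card, hcard] at h
    rw [h]; push_cast; ring
  have hpC : (K.index : ℂ) ≠ 0 := Nat.cast_ne_zero.mpr hp
  have hnp : (n : ℂ) = K.index := by
    have h5 : ((n ^ 2 : ℕ) : ℂ) = ((K.index ^ 2 : ℕ) : ℂ) := by
      push_cast
      have h6 : (K.index + 1 : ℂ) ≠ 0 := Nat.cast_add_one_ne_zero _
      have h7 : (n : ℂ) = -(K.index * c) := eq_neg_of_add_eq_zero_left h1
      apply mul_right_cancel₀ h6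
      rw [h7] at h2 ⊢
      linear_combination (K.index : ℂ) * h2
    exact congrArg Nat.cast (Nat.pow_left_injective two_ne_zero (Nat.cast_injective h5))
  have hc : c = -1 := by
    rw [hnp] at h1
    apply mul_left_cancel₀ hpC
    linear_combination h1
  funext g
  unfold nonlinearChar
  split_ifs with hg1 hgK
  · rw [hg1, FDRep.char_one, ← hnp]
  · have := hin ⟨g, hgK⟩
    rwa [if_neg (by simpa [Subtype.ext_iff] using hg1), hc] at this
  · exact hout g hgK

lemma eq_one_of_mem_kernel {G A : Type*} [Group G] [Finite G] [CommGroup A] (K : Subgroup G)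
    (hn : K.Normal) (hK : K ≠ ⊤)
    (hfrob : ∀ g : G, g ∉ K → ∀ x ∈ K, x ≠ 1 → g * x * g⁻¹ ≠ x) (f : G →* A) {y : G}
    (hy : y ∈ K) : f y = 1 := by
  obtain ⟨g, -, hg⟩ := SetLike.exists_of_lt (lt_top_iff_ne_top.mpr hK)
  obtain ⟨x, -, hx⟩ := exists_conj_eq_mul K hn hfrob hg hy
  have := congrArg f hx
  simpa [mul_comm] using this

lemma card_monoidHom_units_s16 {G : Type*} [Group G] [Finite G] (K : Subgroup G) (hn : K.Normal)
    (hp : K.index.Prime)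
    (hfrob : ∀ g : G, g ∉ K → ∀ x ∈ K, x ≠ 1 → g * x * g⁻¹ ≠ x) :
    Nat.card (G →* ℂˣ) = K.index := by
  have : Fact K.index.Prime := ⟨hp⟩
  have hK : K ≠ ⊤ := fun h => hp.ne_one (Subgroup.index_eq_one.mpr h)
  have : IsCyclic (G ⧸ K) := isCyclic_of_prime_card (p := K.index) rfl
  let _ : CommGroup (G ⧸ K) := IsCyclic.commGroup
  have h := CommGroup.card_monoidHom_of_hasEnoughRootsOfUnity (G ⧸ K) ℂ
  rw [show K.index = Nat.card (G ⧸ K) from rfl, ← h]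
  refine Nat.card_congr ⟨fun f => QuotientGroup.lift K f
    (fun y hy => eq_one_of_mem_kernel K hn hK hfrob f hy),
    fun f => f.comp (QuotientGroup.mk' K), fun f => ?_, fun f => ?_⟩
  · ext; rfl
  · apply QuotientGroup.monoidHom_ext; ext; rfl

lemma Irr_eq_insert_nonlinearChar {G : Type} [Group G] [Fintype G] (K : Subgroup G)
    (hn : K.Normal) (helem : ∀ x ∈ K, x ^ 2 = 1) (hcard : Nat.card K = K.index + 1)
    (hp : K.index.Prime)
    (hfrob : ∀ g : G, g ∉ K → ∀ x ∈ K, x ≠ 1 → g * x * g⁻¹ ≠ x) :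
    Irr G = insert (nonlinearChar K) (Set.range fun (f : G →* ℂˣ) (g : G) => (f g : ℂ)) := by
  have hcomm : ∀ V : FDRep ℂ G, (∀ y ∈ K, V.ρ y = 1) → ∀ a b, V.ρ a * V.ρ b = V.ρ b * V.ρ a := by
    intro V h a b
    have : Fact K.index.Prime := ⟨hp⟩
    have : IsCyclic (G ⧸ K) := isCyclic_of_prime_card (p := K.index) rfl
    let _ : CommGroup (G ⧸ K) := IsCyclic.commGroup
    have hab : (b * a)⁻¹ * (a * b) ∈ K := by
      rw [← QuotientGroup.eq]
      exact mul_comm (b : G ⧸ K) (a : G ⧸ K)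
    rw [← map_mul, ← map_mul, ← mul_inv_cancel_left (b * a) (a * b), map_mul, h _ hab, mul_one]
  ext χ
  constructor
  · rintro ⟨V, hV, rfl⟩
    by_cases h : ∀ y ∈ K, V.ρ y = 1
    · obtain ⟨f, hf⟩ := exists_monoidHom_eq_character V (finrank_eq_one_of_commute V (hcomm V h))
      exact Or.inr ⟨f, funext fun g => (hf g).symm⟩
    · push Not at h
      exact Or.inl (character_eq_nonlinearChar K hn helem hcard hfrob V hV h)
  · rintro (rfl | ⟨f, rfl⟩)
    · have : Nontrivial K := Finite.one_lt_card_iff_nontrivial.mp (by have := hp.pos; omega)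
      obtain ⟨x, hx⟩ := exists_ne (1 : K)
      obtain ⟨V, hV, hVx⟩ := exists_simple_ρ_ne_one (x := (x : G)) (by simpa using hx)
      exact ⟨V, hV, (character_eq_nonlinearChar K hn helem hcard hfrob V hV ⟨x, x.2, hVx⟩).symm⟩
    · obtain ⟨V, hV, hf⟩ := exists_simple_character_eq_monoidHom f
      exact ⟨V, hV, funext hf⟩

lemma charDeg_linear {G : Type} [Group G] (f : G →* ℂˣ) :
    charDeg G (fun g => (f g : ℂ)) = 1 := by
  simp [charDeg]

lemma charDeg_nonlinearChar {G : Type} [Group G] (K : Subgroup G) :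
    charDeg G (nonlinearChar K) = K.index := by
  simp [charDeg, nonlinearChar]

lemma cod_one_s16 {G : Type} [Group G] [Fintype G] : cod G (fun _ => (1 : ℂ)) = 1 := by
  simp [cod, kerSet, charDeg, Nat.div_self Fintype.card_pos]

lemma cod_linear {G : Type} [Group G] [Fintype G] (K : Subgroup G) (hn : K.Normal)
    (hp : K.index.Prime) (hfrob : ∀ g : G, g ∉ K → ∀ x ∈ K, x ≠ 1 → g * x * g⁻¹ ≠ x)
    {f : G →* ℂˣ} (hf : f ≠ 1) : cod G (fun g => (f g : ℂ)) = K.index := by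
  have hK : K ≠ ⊤ := fun h => hp.ne_one (Subgroup.index_eq_one.mpr h)
  have hle : K ≤ f.ker := fun y hy => eq_one_of_mem_kernel K hn hK hfrob f hy
  have hker : f.ker = K := by
    have h1 : f.ker.index ≠ 1 := fun h => hf (by
      rw [Subgroup.index_eq_one] at h
      exact f.ker_eq_top_iff.mp h)
    have h2 := (hp.eq_one_or_self_of_dvd _ (Subgroup.index_dvd_of_le hle)).resolve_left h1
    exact (Subgroup.eq_of_le_of_card_ge hle (by
      have h3 := f.ker.index_mul_card
      rw [h2, ← K.index_mul_card] at h3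
      exact (Nat.eq_of_mul_eq_mul_left hp.pos h3).le)).symm
  have hset : kerSet G (fun g => (f g : ℂ)) = K := by
    rw [← hker]
    ext g
    simp [kerSet, MonoidHom.mem_ker]
  have hKc : (K : Set G).ncard = Nat.card K := rfl
  rw [cod, charDeg_linear, hset, hKc, ← Nat.card_eq_fintype_card, ← K.index_mul_card, Nat.div_one,
    Nat.mul_div_cancel _ Nat.card_pos]

lemma cod_nonlinearChar {G : Type} [Group G] [Fintype G] (K : Subgroup G) :
    cod G (nonlinearChar K) = Nat.card K := by
  have hp : K.index ≠ 0 := Subgroup.index_ne_zero_of_finite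
  have hset : kerSet G (nonlinearChar K) = {1} := by
    ext g
    simp only [kerSet, nonlinearChar, Set.mem_ofPred_eq, if_true, Set.mem_singleton_iff]
    refine ⟨fun h => ?_, fun h => by simp [h]⟩
    by_contra hg
    rw [if_neg hg] at h
    split_ifs at h
    · have : ((K.index + 1 : ℕ) : ℂ) = 0 := by push_cast; rw [← h]; ring
      exact Nat.succ_ne_zero _ (Nat.cast_eq_zero.mp this)
    · exact hp (Nat.cast_eq_zero.mp h.symm)
  rw [cod, charDeg_nonlinearChar, hset, Set.ncard_singleton, Nat.div_one,
    ← Nat.card_eq_fintype_card, ← K.index_mul_card, Nat.mul_div_cancel_left _ (by omega)]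

/-- The Frobenius group `C₂^β ⋊ C_p` with `p = 2^β - 1` prime has a unique
nonlinear irreducible character, its `p - 1` nontrivial linear characters all
have codegree `p`, and it is a `T'_{p-1}`-group. -/
theorem frobenius_c2Beta_cp (G : Type) [Group G] [Fintype G] (β p : ℕ)
    (hβ : 2 ≤ β) (hp : p.Prime) (hpval : p = 2 ^ β - 1)
    (K : Subgroup G) (hn : K.Normal) (helem : ∀ x ∈ K, x ^ 2 = 1)
    (hcard : Nat.card K = 2 ^ β) (hidx : K.index = p)
    (hfrob : ∀ g : G, g ∉ K → ∀ x ∈ K, x ≠ 1 → g * x * g⁻¹ ≠ x) :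
    {χ ∈ Irr G | charDeg G χ ≠ 1}.ncard = 1 ∧
    (∀ χ ∈ Irr G, charDeg G χ = 1 → χ ≠ (fun _ => (1 : ℂ)) → cod G χ = p) ∧
    {χ ∈ Irr G | charDeg G χ = 1 ∧ χ ≠ (fun _ => (1 : ℂ))}.ncard = p - 1 ∧
    IsTk' G (p - 1) := by
  have hpow : 2 ^ β = p + 1 := by have := Nat.one_le_two_pow (n := β); omega
  subst hidx
  rw [hpow] at hcard
  have hIrr := Irr_eq_insert_nonlinearChar K hn helem hcard hp hfrob
  set L : (G →* ℂˣ) → G → ℂ := fun f g => (f g : ℂ) with hL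
  have hLinj : Function.Injective L := fun f₁ f₂ h =>
    MonoidHom.ext fun g => Units.ext (congrFun h g)
  have hL1 : L 1 = fun _ => (1 : ℂ) := by ext; simp [hL]
  have hdegL : ∀ f, charDeg G (L f) = 1 := charDeg_linear
  have hdeg : charDeg G (nonlinearChar K) ≠ 1 := by
    rw [charDeg_nonlinearChar]; exact hp.ne_one
  have hcodL : ∀ f, f ≠ 1 → cod G (L f) = K.index := fun f hf => cod_linear K hn hp hfrob hf
  have hcodL1 : cod G (L 1) = 1 := by rw [hL1, cod_one_s16]
  have hcod : cod G (nonlinearChar K) = K.index + 1 := by rw [cod_nonlinearChar, hcard]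
  have hp1 := hp.one_lt
  have hncard : (L '' {1}ᶜ).ncard = K.index - 1 := by
    have : Finite (G →* ℂˣ) := Nat.finite_of_card_ne_zero
      (by rw [card_monoidHom_units_s16 K hn hp hfrob]; exact hp.ne_zero)
    rw [Set.ncard_image_of_injective _ hLinj, Set.ncard_compl, Set.ncard_singleton,
      card_monoidHom_units_s16 K hn hp hfrob]
  refine ⟨?_, ?_, ?_, K.index, ?_, ?_, ?_⟩
  · rw [Set.ncard_eq_one]
    refine ⟨nonlinearChar K, ?_⟩
    rw [hIrr]
    ext χ
    constructor
    · rintro ⟨rfl | ⟨f, rfl⟩, h⟩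
      · rfl
      · exact absurd (hdegL f) h
    · rintro rfl
      exact ⟨Or.inl rfl, hdeg⟩
  · rw [hIrr]
    rintro χ (rfl | ⟨f, rfl⟩) h1 h
    · exact absurd h1 hdeg
    · exact hcodL f (fun hf => h (by rw [hf, hL1]))
  · rw [← hncard, hIrr]
    congr 1
    ext χ
    constructor
    · rintro ⟨rfl | ⟨f, rfl⟩, h1, h⟩
      · exact absurd h1 hdeg
      · exact ⟨f, fun hf => h (by rw [hf, hL1]), rfl⟩
    · rintro ⟨f, hf, rfl⟩
      exact ⟨Or.inr ⟨f, rfl⟩, hdegL f, fun h => hf (hLinj (h.trans hL1.symm))⟩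
  · have : (L '' {1}ᶜ).Nonempty := by
      apply Set.nonempty_of_ncard_ne_zero
      rw [hncard]; omega
    obtain ⟨_, f, hf, rfl⟩ := this
    exact ⟨L f, hIrr ▸ Or.inr ⟨f, rfl⟩, hcodL f hf⟩
  · rw [codMult, ← hncard, hIrr]
    congr 1
    ext χ
    constructor
    · rintro ⟨rfl | ⟨f, rfl⟩, h⟩
      · omega
      · refine ⟨f, fun hf => ?_, rfl⟩
        rw [hf, hcodL1] at h
        omega
    · rintro ⟨f, hf, rfl⟩
      exact ⟨Or.inr ⟨f, rfl⟩, hcodL f hf⟩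
  · rintro d ⟨χ, hχ, rfl⟩ hd
    rw [codMult, Set.ncard_eq_one]
    refine ⟨χ, Set.eq_singleton_iff_unique_mem.mpr ⟨⟨hχ, rfl⟩, ?_⟩⟩
    rintro ψ ⟨hψ, h⟩
    rw [hIrr] at hχ hψ
    have hlin : ∀ f, cod G (L f) ≠ K.index → f = 1 := fun f hf => by
      by_contra h1
      exact hf (hcodL f h1)
    rcases hχ with rfl | ⟨f, rfl⟩ <;> rcases hψ with rfl | ⟨f', rfl⟩
    · rfl
    · rw [hlin f' (h ▸ hd), hcodL1] at h
      omega
    · rw [hlin f hd, hcodL1] at h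
      omega
    · rw [hlin f hd, hlin f' (h ▸ hd)]
end
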